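/- There exist universal constants C₀ ≥ 20 and K such that for every C ≥ C₀ the following holds. Let ℓ ≥ 1 and let F: ℝ^{2N} → ℝ be a multilinear function mapping {±1}^{2N} into {±1} such that L_{1,2}(F_ρ) ≤ ℓ for every restriction ρ of F. Then |E_{z' ~ D}[F(z')] − F(0,…,0)| ≤ K·ε·ℓ/√N. -/

import Mathlib

open MeasureTheory ProbabilityTheory Finset

noncomputable section

/-- Bit strings of length `n`; there are `N = 2^n` of them. -/
abbrev BV (n : ℕ) := Fin n → Bool

/-- Inner product (mod nothing, just the count) of two bit strings. -/
def bip {n : ℕ} (x y : BV n) : ℕ := (Finset.univ.filter fun i => x i && y i).card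

/-- The `N × N` normalized Walsh-Hadamard matrix, `H_{x,y} = (-1)^{⟨x,y⟩} / √N`. -/
def Had (n : ℕ) : Matrix (BV n) (BV n) ℝ :=
  Matrix.of fun x y => (-1 : ℝ) ^ bip x y / Real.sqrt (2 ^ n)

/-- `ε = 1 / (C ln N)` with `N = 2^n`. -/
def eps (C : ℝ) (n : ℕ) : ℝ := 1 / (C * Real.log (2 ^ n))

/-- The Gaussian vector `X` with i.i.d. `N(0, ε)` coordinates. -/
def gaussVec (C : ℝ) (n : ℕ) : Measure (BV n → ℝ) :=
  Measure.pi fun _ => gaussianReal 0 (eps C n).toNNReal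

/-- The distribution `G'` of `Z = (X, Y∘Y - ε·𝟙)` with `Y = H·X`, packed as a
function on `BV n ⊕ BV n` (first `N` coordinates are `X`, last `N` are `Y∘Y - ε`). -/
def Gmeas' (C : ℝ) (n : ℕ) : Measure (BV n ⊕ BV n → ℝ) :=
  (gaussVec C n).map fun X => Sum.elim X fun i => ((Had n).mulVec X i) ^ 2 - eps C n

/-- Truncation to `[-1, 1]`. -/
def trnc (a : ℝ) : ℝ := min 1 (max (-1) a)

/-- Randomized rounding of `a` to `±1`: output `1` with probability `(1 + trnc a)/2`
and `-1` with probability `(1 - trnc a)/2`. -/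
def roundM (a : ℝ) : Measure ℝ :=
  ((1 + trnc a) / 2).toNNReal • Measure.dirac 1 +
    ((1 - trnc a) / 2).toNNReal • Measure.dirac (-1)

/-- The distribution `D` on `{±1}^{2N}`: sample `z ~ G'` and round each coordinate
independently. -/
def Dmeas (C : ℝ) (n : ℕ) : Measure (BV n ⊕ BV n → ℝ) :=
  (Gmeas' C n).bind fun z => Measure.pi fun i => roundM (z i)

/-- `F : ℝ^ι → ℝ` is multilinear if `F z = Σ_S F̂(S) ∏_{i ∈ S} z_i`. -/
def IsMultilinear {ι : Type*} [Fintype ι] [DecidableEq ι] (F : (ι → ℝ) → ℝ) : Prop :=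
  ∃ c : Finset ι → ℝ, ∀ z, F z = ∑ S : Finset ι, c S * ∏ i ∈ S, z i

/-- The Fourier coefficient `F̂(S)` of `F` (over the hypercube `{±1}^ι`); for a
multilinear `F` these are precisely its multilinear coefficients. -/
def mlCoeff {ι : Type*} [Fintype ι] [DecidableEq ι] (F : (ι → ℝ) → ℝ) (S : Finset ι) : ℝ :=
  (∑ z : ι → Bool, F (fun i => if z i then 1 else -1) * ∏ i ∈ S, (if z i then (1 : ℝ) else -1)) /
    2 ^ Fintype.card ι

/-- `L_{1,2}(F) = Σ_{|S| = 2} |F̂(S)|`. -/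
def L12 {ι : Type*} [Fintype ι] [DecidableEq ι] (F : (ι → ℝ) → ℝ) : ℝ :=
  ∑ S ∈ Finset.univ.filter (fun S : Finset ι => S.card = 2), |mlCoeff F S|

/-- The restriction `F_ρ` of `F` under `ρ = (S, w)`: coordinates outside `S` are
fixed to the values of `w`. -/
def restrictML {ι : Type*} [DecidableEq ι] (F : (ι → ℝ) → ℝ) (S : Finset ι)
    (w : ι → ℝ) : (ι → ℝ) → ℝ :=
  fun y => F fun i => if i ∈ S then y i else w i

/-- `φ(X, Y) = (1/N) Σ_i (Σ_j H_{ij} X_j)² Y_i`. -/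
def phi (n : ℕ) (X Y : BV n → ℝ) : ℝ :=
  (∑ i, ((Had n).mulVec X i) ^ 2 * Y i) / 2 ^ n

/-- The multilinear part `φ_{i≠j}(X, Y) = (1/N) Σ_i Σ_{j ≠ k} H_{ij} H_{ik} X_j X_k Y_i`. -/
def phiOff (n : ℕ) (X Y : BV n → ℝ) : ℝ :=
  (∑ i, ∑ j, ∑ k ∈ Finset.univ \ {j}, Had n i j * Had n i k * X j * X k * Y i) / 2 ^ n

/-- The Fourier coefficient `f̂(x) = 2^{-n} Σ_y f(y) (-1)^{⟨x,y⟩}` of `f : {0,1}^n → {±1}`. -/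
def hatF (n : ℕ) (f : BV n → ℝ) (x : BV n) : ℝ :=
  (∑ y, f y * (-1 : ℝ) ^ bip x y) / 2 ^ n

section Multilinear

variable {ι : Type*} [Fintype ι] [DecidableEq ι]

/-- The mixed partial derivative along `A`, evaluated at `z`, of the multilinear function with
coefficients `c`. It is a sum of products over all coordinates, so that averages over
independent coordinates can be computed factor by factor. -/
def mlDeriv (c : Finset ι → ℝ) (A : Finset ι) (z : ι → ℝ) : ℝ :=
  ∑ T, c T * ∏ k, (if k ∈ A then (if k ∈ T then 1 else 0) else if k ∈ T then z k else 1)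

/-- The sign of a bit, as used in `mlCoeff`. -/
def bitSign (b : Bool) : ℝ := if b then 1 else -1

lemma mlDeriv_empty (c : Finset ι → ℝ) (z : ι → ℝ) :
    mlDeriv c ∅ z = ∑ T, c T * ∏ k ∈ T, z k := by
  simp [mlDeriv, Finset.prod_ite_mem]

lemma mlDeriv_eq_sum_subset (c : Finset ι → ℝ) (A : Finset ι) (z : ι → ℝ) :
    mlDeriv c A z = ∑ T, if A ⊆ T then c T * ∏ k ∈ T \ A, z k else 0 := by
  refine sum_congr rfl fun T _ => ?_
  split_ifs with h
  · congr 1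
    rw [← Finset.univ_inter (T \ A), ← Finset.prod_ite_mem]
    refine Finset.prod_congr rfl fun k _ => ?_
    by_cases hA : k ∈ A
    · simp [hA, h hA]
    · simp [hA]
  · obtain ⟨k, hkA, hkT⟩ := Finset.not_subset.1 h
    rw [Finset.prod_eq_zero (mem_univ k) (by simp [hkA, hkT]), mul_zero]

/-- Averaging a product of functions of independent bits. -/
lemma sum_prod_pi {κ : Type*} [Fintype κ] (g : ι → κ → ℝ) :
    ∑ p : ι → κ, ∏ k, g k (p k) = ∏ k, ∑ a, g k a := by
  rw [Finset.prod_univ_sum, Fintype.piFinset_univ]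

lemma mlDeriv_eq_sum_cube (c : Finset ι → ℝ) (A : Finset ι) (z : ι → ℝ) :
    mlDeriv c A z = ∑ p : ι → Bool, mlDeriv c ∅ (fun k => bitSign (p k)) *
      ∏ k, (if k ∈ A then bitSign (p k) / 2 else (1 + bitSign (p k) * z k) / 2) := by
  simp only [mlDeriv, sum_mul]
  rw [sum_comm]
  refine sum_congr rfl fun T _ => ?_
  simp only [mul_assoc, ← mul_sum, ← prod_mul_distrib]
  congr 1
  rw [sum_prod_pi fun k b => ((if k ∈ (∅ : Finset ι) then (if k ∈ T then (1 : ℝ) else 0) else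
    if k ∈ T then bitSign b else 1) *
      (if k ∈ A then bitSign b / 2 else (1 + bitSign b * z k) / 2))]
  refine prod_congr rfl fun k _ => ?_
  by_cases hA : k ∈ A <;> by_cases hT : k ∈ T <;> simp [hA, hT, bitSign] <;> ring

lemma abs_mlDeriv_le (c : Finset ι → ℝ) (A : Finset ι)
    (hc : ∀ p : ι → Bool, |mlDeriv c ∅ (fun k => bitSign (p k))| ≤ 1) (z : ι → ℝ) :
    |mlDeriv c A z| ≤ ∏ k, max 1 |z k| := by
  rw [mlDeriv_eq_sum_cube]
  calc _ ≤ ∑ p : ι → Bool, ∏ k, |if k ∈ A then bitSign (p k) / 2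
        else (1 + bitSign (p k) * z k) / 2| := by
        refine (abs_sum_le_sum_abs _ _).trans (sum_le_sum fun p _ => ?_)
        rw [abs_mul, abs_prod]
        exact mul_le_of_le_one_left (prod_nonneg fun _ _ => abs_nonneg _) (hc p)
    _ = ∏ k, ∑ b, |if k ∈ A then bitSign b / 2 else (1 + bitSign b * z k) / 2| :=
        sum_prod_pi fun k b => |if k ∈ A then bitSign b / 2 else (1 + bitSign b * z k) / 2|
    _ ≤ _ := by
        refine prod_le_prod (fun _ _ => sum_nonneg fun _ _ => abs_nonneg _) fun k _ => ?_
        by_cases hA : k ∈ A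
        · have : (1 : ℝ) ≤ max 1 |z k| := le_max_left _ _
          simp only [hA, if_true, Fintype.sum_bool, bitSign, Bool.false_eq_true, if_false]
          rw [abs_of_nonneg (by norm_num), abs_of_nonpos (by norm_num)]
          linarith
        · simp only [hA, Fintype.sum_bool, bitSign, Bool.false_eq_true, if_false, if_true]
          have h1 : (1 : ℝ) ≤ max 1 |z k| := le_max_left _ _
          have h2 : |z k| ≤ max 1 |z k| := le_max_right _ _
          have h3 := abs_le.1 h2
          rcases abs_cases ((1 + 1 * z k) / 2) with h | h <;>
          rcases abs_cases ((1 + -1 * z k) / 2) with h' | h' <;> linarith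

lemma mlCoeff_restrictML {F : (ι → ℝ) → ℝ} {c : Finset ι → ℝ}
    (hF : ∀ z, F z = ∑ T, c T * ∏ k ∈ T, z k) (S : Finset ι) (w : ι → ℝ) (A : Finset ι) :
    mlCoeff (restrictML F S w) A = ∑ T, c T * ∏ k,
      (if k ∈ A then (if k ∈ S ∧ k ∈ T then 1 else 0)
        else if k ∈ T then (if k ∈ S then 0 else w k) else 1) := by
  have h2 : (2 : ℝ) ^ Fintype.card ι = ∏ _k : ι, 2 := by simp
  have key (p : ι → Bool) : restrictML F S w (fun i => if p i then 1 else -1) *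
      ∏ i ∈ A, (if p i then (1 : ℝ) else -1) = ∑ T, c T * ∏ k,
        ((if k ∈ T then (if k ∈ S then bitSign (p k) else w k) else 1) *
          (if k ∈ A then bitSign (p k) else 1)) := by
    simp only [restrictML, hF, sum_mul, prod_mul_distrib, mul_assoc, Finset.prod_ite_mem,
      Finset.univ_inter, bitSign]
  simp only [mlCoeff, key]
  rw [sum_comm, sum_div]
  refine sum_congr rfl fun T _ => ?_
  rw [← mul_sum, sum_prod_pi fun k b =>
    (if k ∈ T then (if k ∈ S then bitSign b else w k) else 1) * (if k ∈ A then bitSign b else 1),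
    mul_div_assoc, h2, ← prod_div_distrib]
  congr 1
  refine prod_congr rfl fun k _ => ?_
  by_cases hA : k ∈ A <;> by_cases hT : k ∈ T <;> by_cases hS : k ∈ S <;>
    simp [hA, hT, hS, bitSign]

/-- The probability of each outcome for a coordinate of a random restriction: alive (`none`) with
probability `1/2`, otherwise fixed to a sign whose mean makes the overall mean equal to `x`. -/
def restrictWeight (x : ℝ) : Option Bool → ℝ
  | none => 1 / 2
  | some b => (1 / 2 + bitSign b * x) / 2

/-- The value a coordinate is fixed to by a random restriction. -/
def restrictValue : Option Bool → ℝ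
  | none => 0
  | some b => bitSign b

lemma restrictWeight_nonneg {x : ℝ} (hx : |x| ≤ 1 / 2) (o : Option Bool) :
    0 ≤ restrictWeight x o := by
  have := abs_le.1 hx
  rcases o with _ | _ | _ <;> simp [restrictWeight, bitSign] <;> linarith

lemma sum_restrictWeight_mul_mlCoeff {F : (ι → ℝ) → ℝ} {c : Finset ι → ℝ}
    (hF : ∀ z, F z = ∑ T, c T * ∏ k ∈ T, z k) (z : ι → ℝ) (A : Finset ι) :
    ∑ p : ι → Option Bool, (∏ k, restrictWeight (z k) (p k)) *
        mlCoeff (restrictML F {k | p k = none} fun k => restrictValue (p k)) A =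
      (1 / 2) ^ A.card * mlDeriv c A z := by
  have h2 : (1 / 2 : ℝ) ^ A.card = ∏ k, if k ∈ A then (1 / 2 : ℝ) else 1 := by
    rw [Finset.prod_ite_mem, Finset.univ_inter, prod_const]
  simp only [mlCoeff_restrictML hF, mlDeriv, mul_sum]
  rw [sum_comm]
  refine sum_congr rfl fun T _ => ?_
  simp only [mul_left_comm _ (c T), ← mul_sum, h2, ← prod_mul_distrib, mem_filter, mem_univ,
    true_and]
  congr 1
  rw [sum_prod_pi fun k o => restrictWeight (z k) o *
    (if k ∈ A then (if o = none ∧ k ∈ T then 1 else 0)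
      else if k ∈ T then (if o = none then 0 else restrictValue o) else 1)]
  refine prod_congr rfl fun k _ => ?_
  by_cases hA : k ∈ A <;> by_cases hT : k ∈ T <;>
    simp [hA, hT, bitSign, Fintype.sum_option, restrictWeight, restrictValue] <;> ring

lemma sum_abs_mlDeriv_le {F : (ι → ℝ) → ℝ} {c : Finset ι → ℝ} {l : ℝ}
    (hF : ∀ z, F z = ∑ T, c T * ∏ k ∈ T, z k)
    (hl : ∀ (S : Finset ι) (w : ι → ℝ), (∀ i ∉ S, w i = 1 ∨ w i = -1) →
      L12 (restrictML F S w) ≤ l)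
    (z : ι → ℝ) (hz : ∀ k, |z k| ≤ 1 / 2) :
    ∑ A with A.card = 2, |mlDeriv c A z| ≤ 4 * l := by
  have hw0 (p : ι → Option Bool) : 0 ≤ ∏ k, restrictWeight (z k) (p k) :=
    prod_nonneg fun k _ => restrictWeight_nonneg (hz k) _
  have hw1 : ∑ p : ι → Option Bool, ∏ k, restrictWeight (z k) (p k) = 1 := by
    rw [sum_prod_pi fun k o => restrictWeight (z k) o]
    refine prod_eq_one fun k _ => ?_
    simp [Fintype.sum_option, restrictWeight, bitSign]
    ring
  have hval (p : ι → Option Bool) :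
      L12 (restrictML F {k | p k = none} fun k => restrictValue (p k)) ≤ l := by
    refine hl _ _ fun i hi => ?_
    rcases h : p i with _ | _ | _ <;> simp_all [restrictValue, bitSign]
  calc ∑ A with A.card = 2, |mlDeriv c A z|
      = 4 * ∑ A with A.card = 2, |(1 / 2) ^ A.card * mlDeriv c A z| := by
        rw [mul_sum]
        refine sum_congr rfl fun A hA => ?_
        rw [(mem_filter.1 hA).2, abs_mul, abs_of_nonneg (show (0 : ℝ) ≤ (1 / 2) ^ 2 by norm_num)]
        ring
    _ ≤ 4 * ∑ A with A.card = 2, ∑ p : ι → Option Bool, (∏ k, restrictWeight (z k) (p k)) *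
        |mlCoeff (restrictML F {k | p k = none} fun k => restrictValue (p k)) A| := by
        gcongr with A hA
        rw [← sum_restrictWeight_mul_mlCoeff hF]
        refine (abs_sum_le_sum_abs _ _).trans (sum_le_sum fun p _ => ?_)
        rw [abs_mul, abs_of_nonneg (hw0 p)]
    _ = 4 * ∑ p : ι → Option Bool, (∏ k, restrictWeight (z k) (p k)) *
        L12 (restrictML F {k | p k = none} fun k => restrictValue (p k)) := by
        rw [sum_comm]
        simp only [L12, mul_sum]
    _ ≤ 4 * ∑ p : ι → Option Bool, (∏ k, restrictWeight (z k) (p k)) * l := by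
        gcongr with p
        · exact hw0 p
        · exact hval p
    _ = 4 * l := by rw [← sum_mul, hw1, one_mul]

end Multilinear

section Gaussian

open scoped NNReal

lemma integrable_pow_gaussianReal (v : ℝ≥0) (k : ℕ) :
    Integrable (fun x => x ^ k) (gaussianReal 0 v) := by
  have h := memLp_id_gaussianReal (μ := 0) (v := v) k
  rcases k.eq_zero_or_pos with rfl | hk
  · simp
  have := h.integrable_norm_pow (by omega)
  refine this.mono (by fun_prop) (by simp)

/-- Integration by parts for monomials under a centered Gaussian. -/
lemma integral_pow_succ_gaussianReal {v : ℝ≥0} (hv : v ≠ 0) (k : ℕ) :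
    ∫ x, x ^ (k + 1) ∂(gaussianReal 0 v) = v * (k * ∫ x, x ^ (k - 1) ∂(gaussianReal 0 v)) := by
  have hv' : (v : ℝ) ≠ 0 := by exact_mod_cast hv
  have hint (m : ℕ) : Integrable (fun x : ℝ => gaussianPDFReal 0 v x * x ^ m) := by
    have h := integrable_pow_gaussianReal v m
    rw [gaussianReal_of_var_ne_zero _ hv, gaussianPDF_def,
      integrable_withDensity_iff_integrable_smul' (by fun_prop) (by simp)] at h
    refine h.congr (Filter.Eventually.of_forall fun x => ?_)
    simp [ENNReal.toReal_ofReal (gaussianPDFReal_nonneg 0 v x)]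
  have hder (x : ℝ) : HasDerivAt (fun x => gaussianPDFReal 0 v x * x ^ k)
      (k * (gaussianPDFReal 0 v x * x ^ (k - 1)) -
        (v : ℝ)⁻¹ * (gaussianPDFReal 0 v x * x ^ (k + 1))) x := by
    have h1 : HasDerivAt (fun x => gaussianPDFReal 0 v x)
        (gaussianPDFReal 0 v x * (-x / v)) x := by
      have h2 : HasDerivAt (fun x : ℝ => -(x - 0) ^ 2 / (2 * v)) (-x / v) x := by
        have := ((((hasDerivAt_id x).sub_const 0).pow 2).neg).div_const (2 * (v : ℝ))
        refine this.congr_deriv ?_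
        simp only [id_eq, sub_zero]
        field_simp
        norm_num
      have := (h2.exp).const_mul ((Real.sqrt (2 * Real.pi * v))⁻¹)
      refine this.congr_deriv ?_
      simp only [gaussianPDFReal]
      ring
    refine (h1.mul (hasDerivAt_pow k x)).congr_deriv ?_
    ring
  have h0 := integral_eq_zero_of_hasDerivAt_of_integrable hder
    (((hint _).const_mul _).sub ((hint _).const_mul _)) (hint k)
  rw [integral_sub ((hint _).const_mul _) ((hint _).const_mul _), integral_const_mul,
    integral_const_mul] at h0
  simp only [integral_gaussianReal_eq_integral_smul hv, smul_eq_mul]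
  field_simp at h0
  linarith

variable {ι : Type*} [Fintype ι]

lemma eval_monomial_eq_prod (x : ι → ℝ) (a : ι →₀ ℕ) (c : ℝ) :
    MvPolynomial.eval x (MvPolynomial.monomial a c) = c * ∏ k, x k ^ a k := by
  rw [MvPolynomial.eval_monomial, Finsupp.prod_fintype _ _ (by simp)]

lemma integrable_eval_pi_gaussianReal (v : ℝ≥0) (p : MvPolynomial ι ℝ) :
    Integrable (fun x => MvPolynomial.eval x p) (Measure.pi fun _ => gaussianReal 0 v) := by
  induction p using MvPolynomial.induction_on' with
  | monomial a c =>
    simp only [eval_monomial_eq_prod]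
    exact (Integrable.fintype_prod fun k => integrable_pow_gaussianReal v (a k)).const_mul c
  | add p q hp hq =>
    simp only [map_add]
    exact hp.add hq

variable [DecidableEq ι]

/-- Integration by parts for polynomials under a centered Gaussian with i.i.d. coordinates. -/
lemma integral_X_mul_pi_gaussianReal {v : ℝ≥0} (hv : v ≠ 0) (i : ι) (p : MvPolynomial ι ℝ) :
    ∫ x, MvPolynomial.eval x (MvPolynomial.X i * p) ∂(Measure.pi fun _ => gaussianReal 0 v) =
      v * ∫ x, MvPolynomial.eval x (MvPolynomial.pderiv i p)
        ∂(Measure.pi fun _ => gaussianReal 0 v) := by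
  induction p using MvPolynomial.induction_on' with
  | monomial a c =>
    have hX : (MvPolynomial.X i * MvPolynomial.monomial a c : MvPolynomial ι ℝ) =
        MvPolynomial.monomial (a + Finsupp.single i 1) c := by
      rw [mul_comm, MvPolynomial.X, MvPolynomial.monomial_mul, mul_one]
    rw [hX, MvPolynomial.pderiv_monomial]
    simp only [eval_monomial_eq_prod, integral_const_mul]
    rw [integral_fintype_prod_eq_prod (fun k (t : ℝ) => t ^ (a + Finsupp.single i 1 : ι →₀ ℕ) k),
      integral_fintype_prod_eq_prod (fun k (t : ℝ) => t ^ (a - Finsupp.single i 1 : ι →₀ ℕ) k),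
      ← mul_prod_erase _ _ (mem_univ i), ← mul_prod_erase _ _ (mem_univ i)]
    have h1 : ∏ k ∈ univ.erase i, ∫ t : ℝ, t ^ (a + Finsupp.single i 1 : ι →₀ ℕ) k
          ∂(gaussianReal 0 v) =
        ∏ k ∈ univ.erase i, ∫ t : ℝ, t ^ (a - Finsupp.single i 1 : ι →₀ ℕ) k
          ∂(gaussianReal 0 v) := by
      refine prod_congr rfl fun k hk => ?_
      simp [Finsupp.single_eq_of_ne (ne_of_mem_erase hk)]
    rw [h1]
    simp only [Finsupp.add_apply, Finsupp.tsub_apply, Finsupp.single_eq_same,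
      integral_pow_succ_gaussianReal hv]
    ring
  | add p q hp hq =>
    simp only [mul_add, map_add] at hp hq ⊢
    rw [integral_add (integrable_eval_pi_gaussianReal v _) (integrable_eval_pi_gaussianReal v _),
      integral_add (integrable_eval_pi_gaussianReal v _) (integrable_eval_pi_gaussianReal v _),
      hp, hq, mul_add]

/-- Gaussian integration by parts along a direction `h`. -/
lemma integral_linear_mul_pi_gaussianReal {v : ℝ≥0} (hv : v ≠ 0) (h : ι → ℝ)
    (p : MvPolynomial ι ℝ) :
    ∫ x, MvPolynomial.eval x ((∑ i, MvPolynomial.C (h i) * MvPolynomial.X i) * p)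
        ∂(Measure.pi fun _ => gaussianReal 0 v) =
      v * ∫ x, MvPolynomial.eval x (∑ i, MvPolynomial.C (h i) * MvPolynomial.pderiv i p)
        ∂(Measure.pi fun _ => gaussianReal 0 v) := by
  simp only [sum_mul, mul_assoc, map_sum, MvPolynomial.eval_mul (p := MvPolynomial.C _),
    MvPolynomial.eval_C]
  rw [integral_finsetSum _ fun i _ => (integrable_eval_pi_gaussianReal v _).const_mul _,
    integral_finsetSum _ fun i _ => (integrable_eval_pi_gaussianReal v _).const_mul _, mul_sum]
  refine sum_congr rfl fun i _ => ?_
  rw [integral_const_mul, integral_const_mul, integral_X_mul_pi_gaussianReal hv]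
  ring

end Gaussian

section Hadamard

lemma abs_Had (n : ℕ) (x y : BV n) : |Had n x y| = 1 / Real.sqrt (2 ^ n) := by
  simp [Had, abs_div, abs_pow]

lemma neg_one_pow_bip {n : ℕ} (x y : BV n) :
    (-1 : ℝ) ^ bip x y = ∏ m, if x m && y m then -1 else 1 := by
  rw [bip, ← prod_const, prod_filter]

lemma sum_Had_mul_Had (n : ℕ) (x y : BV n) :
    ∑ k, Had n x k * Had n y k = if x = y then 1 else 0 := by
  have h2 : (2 : ℝ) ^ n = ∏ _m : Fin n, 2 := by simp
  have hs : Real.sqrt (2 ^ n) * Real.sqrt (2 ^ n) = 2 ^ n := Real.mul_self_sqrt (by positivity)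
  simp only [Had, Matrix.of_apply, div_mul_div_comm, hs, neg_one_pow_bip, ← prod_mul_distrib]
  rw [← sum_div, sum_prod_pi fun m b => (if x m && b then (-1 : ℝ) else 1) *
    if y m && b then -1 else 1, h2, ← prod_div_distrib]
  split_ifs with h
  · subst h
    refine prod_eq_one fun m _ => ?_
    cases x m <;> norm_num
  · obtain ⟨m, hm⟩ := Function.ne_iff.1 h
    refine prod_eq_zero (mem_univ m) ?_
    revert hm
    cases x m <;> cases y m <;> simp

lemma Had_mul_transpose (n : ℕ) : Had n * (Had n).transpose = 1 := by
  ext x y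
  simp [Matrix.mul_apply, sum_Had_mul_Had, Matrix.one_apply]

end Hadamard

section Rotation

open scoped NNReal Matrix

variable {ι : Type*} [Fintype ι] [DecidableEq ι]

/-- The i.i.d. centered Gaussian law is invariant under orthogonal matrices. -/
lemma map_mulVec_pi_gaussianReal (v : ℝ≥0) {A : Matrix ι ι ℝ} (hA : A * A.transpose = 1) :
    (Measure.pi fun _ => gaussianReal 0 v).map A.mulVec = Measure.pi fun _ => gaussianReal 0 v := by
  have hAm : Measurable A.mulVec := (Continuous.matrix_mulVec (by fun_prop) (by fun_prop)).measurable
  have hchar (t : EuclideanSpace ℝ ι) :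
      charFun ((Measure.pi fun _ => gaussianReal 0 v).map (WithLp.toLp 2)) t =
        Complex.exp (-(v * (∑ i, t i ^ 2 : ℝ) / 2)) := by
    rw [charFun_pi]
    simp only [charFun_gaussianReal]
    rw [← Complex.exp_sum]
    congr 1
    push_cast
    rw [mul_sum, sum_div, ← sum_neg_distrib]
    simp
  refine (MeasurableEquiv.toLp 2 (ι → ℝ)).map_measurableEquiv_injective <|
    Measure.ext_of_charFun (E := EuclideanSpace ℝ ι) <| funext fun t => ?_
  have h1 : charFun ((((Measure.pi fun _ => gaussianReal 0 v).map A.mulVec)).map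
        (MeasurableEquiv.toLp 2 (ι → ℝ))) t =
      charFun ((Measure.pi fun _ => gaussianReal 0 v).map (WithLp.toLp 2))
        (WithLp.toLp 2 (A.transpose.mulVec t.ofLp)) := by
    rw [← MeasurableEquiv.coe_toLp, charFun_apply, charFun_apply, integral_map_equiv,
      integral_map_equiv, integral_map hAm.aemeasurable]
    · congr 1
      ext x
      have : inner ℝ ((MeasurableEquiv.toLp 2 (ι → ℝ)) (A.mulVec x)) t =
          inner ℝ ((MeasurableEquiv.toLp 2 (ι → ℝ)) x)
            (WithLp.toLp 2 (A.transpose.mulVec t.ofLp)) := by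
        simp only [MeasurableEquiv.coe_toLp, EuclideanSpace.inner_eq_star_dotProduct, star_trivial]
        rw [Matrix.dotProduct_mulVec, ← Matrix.mulVec_transpose, dotProduct_comm]
      rw [this, MeasurableEquiv.coe_toLp]
    · fun_prop
  rw [h1, MeasurableEquiv.coe_toLp, hchar, hchar]
  have h2 : ∑ i, (A.transpose.mulVec t.ofLp) i ^ 2 = ∑ i, t i ^ 2 := by
    have : A.transpose.mulVec t.ofLp ⬝ᵥ A.transpose.mulVec t.ofLp = t.ofLp ⬝ᵥ t.ofLp := by
      rw [Matrix.dotProduct_mulVec, Matrix.vecMul_transpose, Matrix.mulVec_mulVec, hA,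
        Matrix.one_mulVec]
    simpa [dotProduct, sq] using this
  simp only [h2]

end Rotation

section Tail

/-- An exponential weight dominating `max 1 |x| ^ 6 - 1`, and at least `1` off `[-1/2, 1/2]`. -/
def sqExp (ε x : ℝ) : ℝ := Real.exp (x ^ 2 / (4 * ε) - 1 / (16 * ε))

lemma one_le_sqExp {ε x : ℝ} (hε : 0 < ε) (hx : 1 / 2 < |x|) : 1 ≤ sqExp ε x := by
  refine Real.one_le_exp ?_
  have : 1 / 4 ≤ x ^ 2 := by rw [← sq_abs]; nlinarith
  have h : x ^ 2 / (4 * ε) - 1 / (16 * ε) = (x ^ 2 - 1 / 4) / (4 * ε) := by field_simp; ring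
  rw [h]
  exact div_nonneg (by linarith) (by positivity)

lemma max_one_abs_pow_le {ε : ℝ} (hε : 0 < ε) (hε' : ε ≤ 1 / 16) (x : ℝ) :
    max 1 |x| ^ 6 ≤ 1 + sqExp ε x := by
  have h0 : 0 < sqExp ε x := Real.exp_pos _
  rcases le_total |x| 1 with h | h
  · rw [max_eq_left h]
    linarith
  · rw [max_eq_right h]
    have h1 : 1 ≤ x ^ 2 := by rw [← sq_abs]; nlinarith
    have h2 : 3 * x ^ 2 ≤ x ^ 2 / (4 * ε) - 1 / (16 * ε) := by
      have : x ^ 2 / (4 * ε) - 1 / (16 * ε) = (x ^ 2 - 1 / 4) / (4 * ε) := by field_simp; ring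
      rw [this, le_div_iff₀ (by positivity)]
      nlinarith
    calc |x| ^ 6 = (x ^ 2) ^ 3 := by rw [← sq_abs]; ring
      _ ≤ Real.exp (x ^ 2) ^ 3 := by
        gcongr
        linarith [Real.add_one_le_exp (x ^ 2)]
      _ = Real.exp (3 * x ^ 2) := by rw [← Real.exp_nat_mul]; norm_num
      _ ≤ sqExp ε x := Real.exp_le_exp.2 h2
      _ ≤ _ := by linarith

open scoped NNReal

lemma gaussianPDFReal_mul_sqExp {v : ℝ≥0} (hv : v ≠ 0) (x : ℝ) :
    gaussianPDFReal 0 v x * sqExp v x = ((Real.sqrt (2 * Real.pi * v))⁻¹ *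
      Real.exp (-(1 / (16 * v)))) * Real.exp (-(1 / (4 * v)) * x ^ 2) := by
  have hv' : (v : ℝ) ≠ 0 := by exact_mod_cast hv
  rw [gaussianPDFReal, sqExp, mul_assoc (Real.sqrt _)⁻¹, mul_assoc (Real.sqrt _)⁻¹, ← Real.exp_add,
    ← Real.exp_add]
  congr 2
  field_simp
  ring

lemma integrable_sqExp {v : ℝ≥0} (hv : v ≠ 0) : Integrable (sqExp v) (gaussianReal 0 v) := by
  have hv' : (0 : ℝ) < v := by positivity
  rw [gaussianReal_of_var_ne_zero _ hv, gaussianPDF_def,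
    integrable_withDensity_iff_integrable_smul' (by fun_prop) (by simp)]
  have := (integrable_exp_neg_mul_sq (b := 1 / (4 * (v : ℝ))) (by positivity)).const_mul
    ((Real.sqrt (2 * Real.pi * v))⁻¹ * Real.exp (-(1 / (16 * v))))
  refine this.congr (Filter.Eventually.of_forall fun x => ?_)
  simp only [← gaussianPDFReal_mul_sqExp hv, smul_eq_mul,
    ENNReal.toReal_ofReal (gaussianPDFReal_nonneg 0 v x)]

lemma integral_sqExp_le {v : ℝ≥0} (hv : v ≠ 0) :
    ∫ x, sqExp v x ∂(gaussianReal 0 v) ≤ 2 * Real.exp (-(1 / (16 * v))) := by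
  have hv' : (0 : ℝ) < v := by positivity
  rw [integral_gaussianReal_eq_integral_smul hv]
  simp only [smul_eq_mul, gaussianPDFReal_mul_sqExp hv]
  rw [integral_const_mul, integral_gaussian]
  have h : Real.sqrt (Real.pi / (1 / (4 * v))) ≤ 2 * Real.sqrt (2 * Real.pi * v) := by
    rw [show Real.pi / (1 / (4 * (v : ℝ))) = 4 * Real.pi * v by field_simp]
    apply Real.sqrt_le_iff.2
    refine ⟨by positivity, ?_⟩
    rw [mul_pow, Real.sq_sqrt (by positivity)]
    nlinarith [Real.pi_pos, mul_pos Real.pi_pos hv']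
  have hp : 0 < Real.sqrt (2 * Real.pi * v) := by positivity
  calc _ ≤ (Real.sqrt (2 * Real.pi * v))⁻¹ * Real.exp (-(1 / (16 * v))) *
      (2 * Real.sqrt (2 * Real.pi * v)) := by gcongr
    _ = _ := by field_simp

variable {ι : Type*} [Fintype ι]

/-- The excess over `1` of the product of the weights `1 + 2 * sqExp`. -/
def expExcess (ε : ℝ) (x : ι → ℝ) : ℝ := ∏ k, (1 + 2 * sqExp ε (x k)) - 1

lemma expExcess_nonneg (ε : ℝ) (x : ι → ℝ) : 0 ≤ expExcess ε x := by
  have : 1 ≤ ∏ k, (1 + 2 * sqExp ε (x k)) :=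
    Finset.one_le_prod fun k => by simp [sqExp, Real.exp_nonneg]
  exact sub_nonneg.2 this

lemma prod_max_pow_le {ε : ℝ} (hε : 0 < ε) (hε' : ε ≤ 1 / 16) (x : ι → ℝ) :
    (∏ k, max 1 |x k|) ^ 6 ≤ 1 + expExcess ε x := by
  rw [expExcess, add_sub_cancel, ← prod_pow]
  refine prod_le_prod (fun k _ => by positivity) fun k _ => ?_
  have := max_one_abs_pow_le hε hε' (x k)
  have h0 : 0 < sqExp ε (x k) := Real.exp_pos _
  linarith

lemma prod_max_pow_le_of_lt {ε : ℝ} (hε : 0 < ε) (hε' : ε ≤ 1 / 16) (x : ι → ℝ)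
    {i : ι} (hi : 1 / 2 < |x i|) :
    (∏ k, max 1 |x k|) ^ 6 ≤ expExcess ε x := by
  classical
  rw [expExcess, ← prod_pow, ← mul_prod_erase _ _ (mem_univ i),
    ← mul_prod_erase _ (fun k => 1 + 2 * sqExp ε (x k)) (mem_univ i)]
  have h0 (k : ι) : 0 < sqExp ε (x k) := Real.exp_pos _
  have h1 : ∏ k ∈ univ.erase i, max 1 |x k| ^ 6 ≤ ∏ k ∈ univ.erase i, (1 + 2 * sqExp ε (x k)) :=
    prod_le_prod (fun k _ => by positivity) fun k _ => by
      linarith [max_one_abs_pow_le hε hε' (x k), h0 k]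
  have h2 : 1 ≤ ∏ k ∈ univ.erase i, (1 + 2 * sqExp ε (x k)) :=
    Finset.one_le_prod fun k _ => by linarith [h0 k]
  have h3 := max_one_abs_pow_le hε hε' (x i)
  have h4 := one_le_sqExp hε hi
  have h5 : max 1 |x i| ^ 6 * ∏ k ∈ univ.erase i, max 1 |x k| ^ 6 ≤
      (2 * sqExp ε (x i)) * ∏ k ∈ univ.erase i, (1 + 2 * sqExp ε (x k)) :=
    mul_le_mul (by linarith) h1 (prod_nonneg fun k _ => by positivity) (by linarith)
  linarith

/-- A smooth dominating function for everything that happens off the cube `[-1/2, 1/2]`. -/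
def tailBound (ε δ : ℝ) (x y : ι → ℝ) : ℝ :=
  (δ * (1 + expExcess ε x) + expExcess ε x / δ + (δ * (1 + expExcess ε y) + expExcess ε y / δ)) / 2

lemma tailBound_nonneg {ε δ : ℝ} (hδ : 0 < δ) (x y : ι → ℝ) : 0 ≤ tailBound ε δ x y := by
  have := expExcess_nonneg ε x
  have := expExcess_nonneg ε y
  unfold tailBound
  positivity

lemma mul_le_half_weighted {δ : ℝ} (hδ : 0 < δ) (a b : ℝ) : a * b ≤ (δ * a ^ 2 + b ^ 2 / δ) / 2 := by
  have h : (δ * a ^ 2 + b ^ 2 / δ) / 2 - a * b = (δ * a - b) ^ 2 / (2 * δ) := by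
    field_simp
    ring
  have : 0 ≤ (δ * a - b) ^ 2 / (2 * δ) := by positivity
  linarith

lemma one_le_prod_max (x : ι → ℝ) : 1 ≤ ∏ k, max 1 |x k| :=
  Finset.one_le_prod fun _ _ => le_max_left _ _

lemma prod_max_mul_le_tailBound {ε δ : ℝ} (hε : 0 < ε) (hε' : ε ≤ 1 / 16) (hδ : 0 < δ)
    (x y : ι → ℝ) (h : (∃ i, 1 / 2 < |x i|) ∨ ∃ i, 1 / 2 < |y i|) :
    (∏ k, max 1 |x k|) * (∏ k, max 1 |y k|) ^ 3 ≤ tailBound ε δ x y := by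
  have hx0 := expExcess_nonneg ε x
  have hy0 := expExcess_nonneg ε y
  have hx6 := prod_max_pow_le hε hε' x
  have hy6 := prod_max_pow_le hε hε' y
  have hx1 := one_le_prod_max x
  have hx2 : (∏ k, max 1 |x k|) ^ 2 ≤ (∏ k, max 1 |x k|) ^ 6 := pow_le_pow_right₀ hx1 (by norm_num)
  unfold tailBound
  rcases h with ⟨i, hi⟩ | ⟨i, hi⟩
  · have hb := prod_max_pow_le_of_lt hε hε' x hi
    calc _ = (∏ k, max 1 |y k|) ^ 3 * (∏ k, max 1 |x k|) := mul_comm _ _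
      _ ≤ _ := mul_le_half_weighted hδ _ _
      _ ≤ (δ * (1 + expExcess ε y) + expExcess ε x / δ) / 2 := by
        rw [← pow_mul]
        gcongr
        exact hx2.trans hb
      _ ≤ _ := by
        have : 0 ≤ δ * (1 + expExcess ε x) + expExcess ε y / δ := by positivity
        linarith
  · have hb := prod_max_pow_le_of_lt hε hε' y hi
    calc _ ≤ _ := mul_le_half_weighted hδ _ _
      _ ≤ (δ * (1 + expExcess ε x) + expExcess ε y / δ) / 2 := by
        rw [← pow_mul]
        gcongr
        exact hx2.trans hx6
      _ ≤ _ := by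
        have : 0 ≤ δ * (1 + expExcess ε y) + expExcess ε x / δ := by positivity
        linarith

lemma integrable_expExcess {v : ℝ≥0} (hv : v ≠ 0) :
    Integrable (fun x : ι → ℝ => expExcess v x) (Measure.pi fun _ => gaussianReal 0 v) :=
  (Integrable.fintype_prod fun _ =>
    (integrable_const (1 : ℝ)).add ((integrable_sqExp hv).const_mul 2)).sub (integrable_const 1)

lemma integral_expExcess_le {v : ℝ≥0} (hv : v ≠ 0)
    (h : 4 * Real.exp (-(1 / (16 * v))) * Fintype.card ι ≤ 1) :
    ∫ x : ι → ℝ, expExcess v x ∂(Measure.pi fun _ => gaussianReal 0 v) ≤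
      8 * Real.exp (-(1 / (16 * v))) * Fintype.card ι := by
  have hi : Integrable (fun x => 1 + 2 * sqExp v x) (gaussianReal 0 v) :=
    (integrable_const (1 : ℝ)).add ((integrable_sqExp hv).const_mul 2)
  have h1 : ∫ x, (1 + 2 * sqExp v x) ∂(gaussianReal 0 v) ≤
      Real.exp (4 * Real.exp (-(1 / (16 * v)))) := by
    rw [integral_add (integrable_const _) ((integrable_sqExp hv).const_mul 2), integral_const_mul]
    have := integral_sqExp_le hv
    have := Real.add_one_le_exp (4 * Real.exp (-(1 / (16 * (v : ℝ)))))
    simp only [integral_const, probReal_univ, smul_eq_mul, mul_one]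
    linarith
  unfold expExcess
  rw [integral_sub (Integrable.fintype_prod fun _ => hi) (integrable_const 1),
    integral_fintype_prod_eq_prod (fun _ (t : ℝ) => 1 + 2 * sqExp v t), prod_const, card_univ]
  have h2 : (∫ x, (1 + 2 * sqExp v x) ∂(gaussianReal 0 v)) ^ Fintype.card ι ≤
      Real.exp (4 * Real.exp (-(1 / (16 * v))) * Fintype.card ι) := by
    rw [mul_comm, Real.exp_nat_mul]
    gcongr
    exact integral_nonneg fun x => by simp only [Pi.zero_apply, sqExp]; positivity
  have h3 := Real.abs_exp_sub_one_le (x := 4 * Real.exp (-(1 / (16 * v))) * Fintype.card ι)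
    (by rwa [abs_of_nonneg (by positivity)])
  rw [abs_of_nonneg (a := 4 * Real.exp (-(1 / (16 * v))) * Fintype.card ι) (by positivity)] at h3
  have h4 := (abs_le.1 h3).2
  simp only [integral_const, probReal_univ, smul_eq_mul, mul_one]
  linarith

end Tail

section Interpolation

variable {ι : Type*} [Fintype ι]

lemma derivation_prod {R A κ : Type*} [CommSemiring R] [CommSemiring A] [Algebra R A]
    [DecidableEq κ] (D : Derivation R A A) (T : Finset κ) (f : κ → A) :
    D (∏ k ∈ T, f k) = ∑ k ∈ T, (∏ m ∈ T.erase k, f m) * D (f k) := by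
  induction T using Finset.induction_on with
  | empty => simp
  | insert a T ha ih =>
    rw [prod_insert ha, D.leibniz, ih, sum_insert ha, erase_insert ha, smul_eq_mul, smul_eq_mul,
      mul_sum, add_comm]
    congr 1
    refine sum_congr rfl fun k hk => ?_
    have hka : a ≠ k := fun h => ha (h ▸ hk)
    rw [erase_insert_of_ne hka, prod_insert (fun h => ha (mem_of_mem_erase h)), mul_assoc]

/-- The polynomial `(H x)_j`. -/
def linForm (H : Matrix ι ι ℝ) (j : ι) : MvPolynomial ι ℝ :=
  ∑ i, MvPolynomial.C (H j i) * MvPolynomial.X i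

/-- The coordinates of `(x, (H x) ∘ (H x) - ε)` as polynomials in `x`. -/
def quadVar (H : Matrix ι ι ℝ) (ε : ℝ) : ι ⊕ ι → MvPolynomial ι ℝ :=
  Sum.elim MvPolynomial.X fun j => linForm H j ^ 2 - MvPolynomial.C ε

/-- The derivative along the `j`-th row of `H`. -/
def rowDeriv (H : Matrix ι ι ℝ) (j : ι) :
    Derivation ℝ (MvPolynomial ι ℝ) (MvPolynomial ι ℝ) :=
  ∑ i, H j i • MvPolynomial.pderiv i

lemma rowDeriv_apply (H : Matrix ι ι ℝ) (j : ι) (p : MvPolynomial ι ℝ) :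
    rowDeriv H j p = ∑ i, MvPolynomial.C (H j i) * MvPolynomial.pderiv i p := by
  have : rowDeriv H j p = ∑ i, (H j i • MvPolynomial.pderiv i) p := by
    rw [rowDeriv, ← Derivation.coeFnAddMonoidHom_apply, map_sum, Finset.sum_apply]
    rfl
  rw [this]
  exact sum_congr rfl fun i _ => by rw [Derivation.smul_apply, MvPolynomial.smul_eq_C_mul]

lemma eval_linForm (H : Matrix ι ι ℝ) (j : ι) (x : ι → ℝ) :
    MvPolynomial.eval x (linForm H j) = H.mulVec x j := by
  simp [linForm, Matrix.mulVec, dotProduct]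

variable [DecidableEq ι]

lemma rowDeriv_X (H : Matrix ι ι ℝ) (j i : ι) :
    rowDeriv H j (MvPolynomial.X i) = MvPolynomial.C (H j i) := by
  rw [rowDeriv_apply, sum_eq_single i]
  · simp
  · intro k _ hk
    rw [MvPolynomial.pderiv_X_of_ne hk.symm, mul_zero]
  · simp

lemma rowDeriv_linForm {H : Matrix ι ι ℝ} (hH : H * H.transpose = 1) (j k : ι) :
    rowDeriv H j (linForm H k) = if j = k then 1 else 0 := by
  have h1 : rowDeriv H j (linForm H k) = MvPolynomial.C ((H * H.transpose) j k) := by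
    rw [linForm, map_sum, Matrix.mul_apply, map_sum]
    refine sum_congr rfl fun i _ => ?_
    rw [← MvPolynomial.smul_eq_C_mul, Derivation.map_smul, rowDeriv_X,
      MvPolynomial.smul_eq_C_mul, Matrix.transpose_apply, ← map_mul, mul_comm]
  rw [h1, hH, Matrix.one_apply]
  split_ifs <;> simp

lemma rowDeriv_quadVar_inr {H : Matrix ι ι ℝ} (hH : H * H.transpose = 1) (ε : ℝ) {j k : ι}
    (hjk : j ≠ k) : rowDeriv H j (quadVar H ε (Sum.inr k)) = 0 := by
  simp [quadVar, rowDeriv_linForm hH, hjk, MvPolynomial.derivation_C]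

/-- Gaussian integration by parts along the `j`-th row of `H`, applied to a monomial that
contains the `j`-th quadratic variable. -/
lemma integral_prod_quadVar {H : Matrix ι ι ℝ} (hH : H * H.transpose = 1) {v : NNReal}
    (hv : v ≠ 0) {T : Finset (ι ⊕ ι)} {j : ι} (hj : Sum.inr j ∈ T) :
    ∫ x, MvPolynomial.eval x (∏ k ∈ T, quadVar H v k) ∂(Measure.pi fun _ => gaussianReal 0 v) =
      v * ∑ i, if Sum.inl i ∈ T then H j i *
        ∫ x, MvPolynomial.eval x (linForm H j * ∏ k ∈ T \ {Sum.inl i, Sum.inr j}, quadVar H v k)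
          ∂(Measure.pi fun _ => gaussianReal 0 v) else 0 := by
  set P := ∏ k ∈ T.erase (Sum.inr j), quadVar H v k with hP
  have h1 : ∏ k ∈ T, quadVar H v k = linForm H j * (linForm H j * P) - MvPolynomial.C (v : ℝ) * P := by
    rw [← mul_prod_erase T _ hj, ← hP]
    simp only [quadVar, Sum.elim_inr]
    ring
  have h2 : rowDeriv H j P = ∑ i, if Sum.inl i ∈ T then MvPolynomial.C (H j i) *
      ∏ k ∈ T \ {Sum.inl i, Sum.inr j}, quadVar H v k else 0 := by
    have h3 : ∀ k : ι, (if Sum.inr k ∈ T.erase (Sum.inr j) then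
        (∏ m ∈ (T.erase (Sum.inr j)).erase (Sum.inr k), quadVar H v m) *
          rowDeriv H j (quadVar H v (Sum.inr k)) else 0) = 0 := by
      intro k
      split_ifs with hk
      · rw [rowDeriv_quadVar_inr hH v fun h => ne_of_mem_erase hk (by rw [h]), mul_zero]
      · rfl
    rw [hP, derivation_prod, ← Fintype.sum_ite_mem,
      Fintype.sum_sum_type, sum_eq_zero fun k _ => h3 k, add_zero]
    refine sum_congr rfl fun i _ => ?_
    have h4 : (T.erase (Sum.inr j)).erase (Sum.inl i) = T \ {Sum.inl i, Sum.inr j} := by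
      ext k
      simp only [mem_erase, mem_sdiff, mem_insert, mem_singleton]
      tauto
    rw [h4, quadVar, Sum.elim_inl, rowDeriv_X, mul_comm]
    simp
  have h5 : rowDeriv H j (linForm H j * P) = P + linForm H j * rowDeriv H j P := by
    rw [Derivation.leibniz, rowDeriv_linForm hH, if_pos rfl, smul_eq_mul, smul_eq_mul, mul_one,
      add_comm]
  have h6 := integral_linear_mul_pi_gaussianReal hv (H j) (linForm H j * P)
  rw [← rowDeriv_apply, h5, ← linForm] at h6
  simp only [h1, map_sub, map_add, MvPolynomial.eval_mul (p := MvPolynomial.C _),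
    MvPolynomial.eval_C] at h6 ⊢
  rw [integral_sub (integrable_eval_pi_gaussianReal v _)
    ((integrable_eval_pi_gaussianReal v _).const_mul _), h6,
    integral_add (integrable_eval_pi_gaussianReal v _) (integrable_eval_pi_gaussianReal v _),
    integral_const_mul, mul_add, add_sub_cancel_left, h2, mul_sum]
  simp only [map_sum]
  rw [integral_finsetSum _ fun i _ => integrable_eval_pi_gaussianReal v _]
  congr 1
  refine sum_congr rfl fun i _ => ?_
  split_ifs
  · rw [← integral_const_mul]
    refine integral_congr_ae (ae_of_all _ fun x => ?_)
    simp only [map_mul, MvPolynomial.eval_C]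
    ring
  · simp

/-- The point `(x, r ((H x) ∘ (H x) - ε))`. -/
def interpPoint (H : Matrix ι ι ℝ) (ε r : ℝ) (x : ι → ℝ) : ι ⊕ ι → ℝ :=
  Sum.elim x fun j => r * (H.mulVec x j ^ 2 - ε)

/-- The number of elements of `S` in the right summand. -/
def cardInr (S : Finset (ι ⊕ ι)) : ℕ := #{j | Sum.inr j ∈ S}

lemma prod_interpPoint (H : Matrix ι ι ℝ) (ε r : ℝ) (x : ι → ℝ) (S : Finset (ι ⊕ ι)) :
    ∏ k ∈ S, interpPoint H ε r x k =
      r ^ cardInr S * MvPolynomial.eval x (∏ k ∈ S, quadVar H ε k) := by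
  have h : ∀ k, interpPoint H ε r x k =
      Sum.elim (fun _ => 1) (fun _ => r) k * MvPolynomial.eval x (quadVar H ε k) := by
    rintro (i | j) <;> simp [interpPoint, quadVar, eval_linForm]
  rw [prod_congr rfl fun k _ => h k, prod_mul_distrib, map_prod]
  congr 1
  rw [← univ_inter S, ← prod_ite_mem, Fintype.prod_sum_type]
  simp only [Sum.elim_inl, Sum.elim_inr, ite_self, prod_const_one, one_mul]
  rw [prod_ite]
  simp [cardInr]

lemma cardInr_sdiff_pair {T : Finset (ι ⊕ ι)} {i j : ι} (hj : Sum.inr j ∈ T) :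
    cardInr (T \ {Sum.inl i, Sum.inr j}) = cardInr T - 1 := by
  have : ({k | Sum.inr k ∈ T \ {Sum.inl i, Sum.inr j}} : Finset ι) =
      ({k | Sum.inr k ∈ T} : Finset ι).erase j := by
    ext k
    simp [and_comm]
  rw [cardInr, this, card_erase_of_mem (by simpa using hj), cardInr]

lemma integrable_linForm_mul_mlDeriv (H : Matrix ι ι ℝ) (v : NNReal) (r : ℝ)
    (c : Finset (ι ⊕ ι) → ℝ) (A : Finset (ι ⊕ ι)) (j : ι) :
    Integrable (fun x => H.mulVec x j * mlDeriv c A (interpPoint H v r x))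
      (Measure.pi fun _ => gaussianReal 0 v) := by
  simp only [mlDeriv_eq_sum_subset, mul_sum, prod_interpPoint]
  refine integrable_finsetSum _ fun T _ => ?_
  split_ifs
  · refine ((integrable_eval_pi_gaussianReal v
      (linForm H j * ∏ k ∈ T \ A, quadVar H v k)).const_mul (c T * r ^ cardInr (T \ A))).congr
      (ae_of_all _ fun x => ?_)
    simp only [map_mul, eval_linForm]
    ring
  · simp

lemma integral_linForm_mul_mlDeriv (H : Matrix ι ι ℝ) (v : NNReal) (r : ℝ)
    (c : Finset (ι ⊕ ι) → ℝ) (A : Finset (ι ⊕ ι)) (j : ι) :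
    ∫ x, H.mulVec x j * mlDeriv c A (interpPoint H v r x)
      ∂(Measure.pi fun _ => gaussianReal 0 v) =
    ∑ T, if A ⊆ T then c T * r ^ cardInr (T \ A) *
      ∫ x, MvPolynomial.eval x (linForm H j * ∏ k ∈ T \ A, quadVar H v k)
        ∂(Measure.pi fun _ => gaussianReal 0 v) else 0 := by
  have h : ∀ x, H.mulVec x j * mlDeriv c A (interpPoint H v r x) = ∑ T, if A ⊆ T then
      c T * r ^ cardInr (T \ A) *
        MvPolynomial.eval x (linForm H j * ∏ k ∈ T \ A, quadVar H v k) else 0 := by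
    intro x
    rw [mlDeriv_eq_sum_subset, mul_sum]
    refine sum_congr rfl fun T _ => ?_
    split_ifs
    · rw [prod_interpPoint, map_mul, eval_linForm]
      ring
    · simp
  simp only [h]
  rw [integral_finsetSum]
  · refine sum_congr rfl fun T _ => ?_
    split_ifs
    · rw [integral_const_mul]
    · simp
  · intro T _
    split_ifs
    · exact (integrable_eval_pi_gaussianReal v _).const_mul _
    · simp

/-- The expectation of the multilinear polynomial with coefficients `c` at `interpPoint`. -/
def interpMean (H : Matrix ι ι ℝ) (v : NNReal) (c : Finset (ι ⊕ ι) → ℝ) (r : ℝ) : ℝ :=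
  ∫ x, mlDeriv c ∅ (interpPoint H v r x) ∂(Measure.pi fun _ => gaussianReal 0 v)

lemma interpMean_eq_sum (H : Matrix ι ι ℝ) (v : NNReal) (c : Finset (ι ⊕ ι) → ℝ) (r : ℝ) :
    interpMean H v c r = ∑ T, c T * r ^ cardInr T *
      ∫ x, MvPolynomial.eval x (∏ k ∈ T, quadVar H v k)
        ∂(Measure.pi fun _ => gaussianReal 0 v) := by
  simp only [interpMean, mlDeriv_empty, prod_interpPoint, ← mul_assoc]
  rw [integral_finsetSum _ fun T _ => (integrable_eval_pi_gaussianReal v _).const_mul _]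
  simp only [integral_const_mul]

lemma hasDerivAt_interpMean {H : Matrix ι ι ℝ} (hH : H * H.transpose = 1) {v : NNReal}
    (hv : v ≠ 0) (c : Finset (ι ⊕ ι) → ℝ) (r : ℝ) :
    HasDerivAt (interpMean H v c) (v * ∑ j, ∑ i, H j i *
      ∫ x, H.mulVec x j * mlDeriv c {Sum.inl i, Sum.inr j} (interpPoint H v r x)
        ∂(Measure.pi fun _ => gaussianReal 0 v)) r := by
  have h : HasDerivAt (fun r => ∑ T, c T * r ^ cardInr T *
      ∫ x, MvPolynomial.eval x (∏ k ∈ T, quadVar H v k)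
        ∂(Measure.pi fun _ => gaussianReal 0 v)) (∑ T, c T * (cardInr T * r ^ (cardInr T - 1)) *
      ∫ x, MvPolynomial.eval x (∏ k ∈ T, quadVar H v k)
        ∂(Measure.pi fun _ => gaussianReal 0 v)) r :=
    HasDerivAt.fun_sum fun T _ => ((hasDerivAt_pow _ r).const_mul _).mul_const _
  rw [funext (interpMean_eq_sum H v c)]
  convert h using 1
  simp only [integral_linForm_mul_mlDeriv, mul_sum]
  rw [sum_congr rfl fun j _ => sum_comm, sum_comm]
  refine sum_congr rfl fun T _ => ?_
  have h1 : ∀ j, (∑ i, (v : ℝ) * (H j i * if {Sum.inl i, Sum.inr j} ⊆ T then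
      c T * r ^ cardInr (T \ {Sum.inl i, Sum.inr j}) *
      ∫ x, MvPolynomial.eval x (linForm H j * ∏ k ∈ T \ {Sum.inl i, Sum.inr j}, quadVar H v k)
        ∂(Measure.pi fun _ => gaussianReal 0 v) else 0)) =
      if Sum.inr j ∈ T then c T * r ^ (cardInr T - 1) *
        ∫ x, MvPolynomial.eval x (∏ k ∈ T, quadVar H v k)
          ∂(Measure.pi fun _ => gaussianReal 0 v) else 0 := by
    intro j
    split_ifs with hj
    · rw [integral_prod_quadVar hH hv hj, mul_sum, mul_sum]
      refine sum_congr rfl fun i _ => ?_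
      simp only [insert_subset_iff, singleton_subset_iff, hj, and_true, cardInr_sdiff_pair hj]
      split_ifs
      · ring
      · simp
    · refine sum_eq_zero fun i _ => ?_
      simp [insert_subset_iff, hj]
  rw [sum_congr rfl fun j _ => h1 j, ← sum_filter, sum_const, nsmul_eq_mul, cardInr]
  ring

lemma interpMean_zero (H : Matrix ι ι ℝ) (v : NNReal) (c : Finset (ι ⊕ ι) → ℝ) :
    interpMean H v c 0 = c ∅ := by
  rw [interpMean_eq_sum, sum_eq_single ∅]
  · simp [cardInr]
  · intro T _ hT
    by_cases h : cardInr T = 0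
    · have hr : ∀ j, Sum.inr j ∉ T := by
        simpa [cardInr, filter_eq_empty_iff] using h
      obtain ⟨k, hk⟩ := nonempty_iff_ne_empty.2 hT
      obtain ⟨i, hi⟩ : ∃ i, Sum.inl i ∈ T := by
        rcases k with i | j
        · exact ⟨i, hk⟩
        · exact absurd hk (hr j)
      have h1 : ∀ x, MvPolynomial.eval x (∏ k ∈ T, quadVar H v k) =
          ∏ i, (fun (i : ι) (t : ℝ) => if Sum.inl i ∈ T then t else 1) i (x i) := by
        intro x
        conv_lhs => rw [← univ_inter T, ← prod_ite_mem, Fintype.prod_sum_type]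
        simp only [hr, if_false, prod_const_one, mul_one, map_prod]
        refine prod_congr rfl fun i _ => ?_
        split_ifs <;> simp [quadVar]
      rw [integral_congr_ae (ae_of_all _ h1), integral_fintype_prod_eq_prod (𝕜 := ℝ)
        (fun (i : ι) (t : ℝ) => if Sum.inl i ∈ T then t else 1), prod_eq_zero (mem_univ i), mul_zero]
      simp [hi, integral_id_gaussianReal]
    · simp [h]
  · simp

end Interpolation

section Bounds

variable {ι : Type*} [Fintype ι]

lemma abs_le_prod_max {κ : Type*} [Fintype κ] [DecidableEq κ] (y : κ → ℝ) (j : κ) :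
    |y j| ≤ ∏ k, max 1 |y k| := by
  rw [← mul_prod_erase _ _ (mem_univ j)]
  exact (le_max_right _ _).trans (le_mul_of_one_le_right (by positivity)
    (Finset.one_le_prod fun k _ => le_max_left _ _))

lemma abs_interp_le_of_abs_le_half {ε r y : ℝ} (hε : 0 < ε) (hε' : ε ≤ 1 / 16) (hr : 0 ≤ r)
    (hr' : r ≤ 1) (hy : |y| ≤ 1 / 2) : |r * (y ^ 2 - ε)| ≤ 1 / 2 := by
  have h1 : y ^ 2 ≤ 1 / 4 := by rw [← sq_abs]; nlinarith [abs_nonneg y]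
  have h2 : |y ^ 2 - ε| ≤ 1 / 2 := abs_le.2 ⟨by nlinarith [sq_nonneg y], by linarith⟩
  rw [abs_mul, abs_of_nonneg hr]
  nlinarith [abs_nonneg (y ^ 2 - ε)]

lemma max_one_abs_interp_le {ε r : ℝ} (y : ℝ) (hε : 0 < ε) (hε' : ε ≤ 1 / 16) (hr : 0 ≤ r)
    (hr' : r ≤ 1) : max 1 |r * (y ^ 2 - ε)| ≤ max 1 |y| ^ 2 := by
  have h0 : (1 : ℝ) ≤ max 1 |y| := le_max_left _ _
  have h1 : (1 : ℝ) ≤ max 1 |y| ^ 2 := one_le_pow₀ h0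
  have h2 : y ^ 2 ≤ max 1 |y| ^ 2 := by
    rw [← sq_abs]
    exact pow_le_pow_left₀ (abs_nonneg y) (le_max_right _ _) 2
  have h3 : |y ^ 2 - ε| ≤ max 1 |y| ^ 2 :=
    abs_le.2 ⟨by nlinarith [sq_nonneg y], by linarith⟩
  refine max_le h1 ?_
  rw [abs_mul, abs_of_nonneg hr]
  nlinarith [abs_nonneg (y ^ 2 - ε)]

lemma prod_max_interpPoint_le (H : Matrix ι ι ℝ) {ε r : ℝ} (x : ι → ℝ) (hε : 0 < ε)
    (hε' : ε ≤ 1 / 16) (hr : 0 ≤ r) (hr' : r ≤ 1) :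
    ∏ k, max 1 |interpPoint H ε r x k| ≤
      (∏ k, max 1 |x k|) * (∏ k, max 1 |H.mulVec x k|) ^ 2 := by
  rw [Fintype.prod_sum_type, ← prod_pow]
  refine mul_le_mul_of_nonneg_left (prod_le_prod (fun j _ => by positivity) fun j _ => ?_)
    (prod_nonneg fun i _ => by positivity)
  exact max_one_abs_interp_le _ hε hε' hr hr'

lemma abs_interpPoint_le_half (H : Matrix ι ι ℝ) {ε r : ℝ} {x : ι → ℝ} (hε : 0 < ε)
    (hε' : ε ≤ 1 / 16) (hr : 0 ≤ r) (hr' : r ≤ 1) (hx : ∀ i, |x i| ≤ 1 / 2)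
    (hy : ∀ j, |H.mulVec x j| ≤ 1 / 2) : ∀ k, |interpPoint H ε r x k| ≤ 1 / 2 := by
  rintro (i | j)
  · exact hx i
  · exact abs_interp_le_of_abs_le_half hε hε' hr hr' (hy j)

lemma continuous_interpPoint (H : Matrix ι ι ℝ) (ε r : ℝ) : Continuous (interpPoint H ε r) := by
  refine continuous_pi fun k => ?_
  rcases k with i | j
  · exact continuous_apply i
  · simp only [interpPoint, Sum.elim_inr, Matrix.mulVec, dotProduct]
    fun_prop

lemma measurable_mulVec (H : Matrix ι ι ℝ) : Measurable H.mulVec :=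
  (Continuous.matrix_mulVec (by fun_prop) (by fun_prop)).measurable

variable [DecidableEq ι]

lemma sum_pairs_le_sum_card_two {f : Finset (ι ⊕ ι) → ℝ} (hf : ∀ A, 0 ≤ f A) :
    ∑ j, ∑ i, f {Sum.inl i, Sum.inr j} ≤ ∑ A with A.card = 2, f A := by
  have hinj : Function.Injective fun p : ι × ι => ({Sum.inl p.2, Sum.inr p.1} : Finset (ι ⊕ ι)) := by
    rintro ⟨a, b⟩ ⟨a', b'⟩ h
    have h1 := Finset.ext_iff.1 h
    have h2 := h1 (Sum.inl b)
    have h3 := h1 (Sum.inr a)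
    simp at h2 h3
    simp [h2, h3]
  rw [← Fintype.sum_prod_type' fun j i => f {Sum.inl i, Sum.inr j}]
  rw [← sum_image (f := f) fun p _ q _ h => hinj h]
  refine sum_le_sum_of_subset_of_nonneg (fun A hA => ?_) fun A _ _ => hf A
  obtain ⟨p, -, rfl⟩ := mem_image.1 hA
  simp

lemma sum_abs_mulVec_mul_mlDeriv_le (H : Matrix ι ι ℝ) {c : Finset (ι ⊕ ι) → ℝ} {ε δ r l : ℝ}
    (hε : 0 < ε) (hε' : ε ≤ 1 / 16) (hδ : 0 < δ) (hr : 0 ≤ r) (hr' : r ≤ 1) (hl : 0 ≤ l)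
    (hb : ∀ A z, |mlDeriv c A z| ≤ ∏ k, max 1 |z k|)
    (hs : ∀ z, (∀ k, |z k| ≤ 1 / 2) → ∑ A with A.card = 2, |mlDeriv c A z| ≤ 4 * l)
    (x : ι → ℝ) :
    ∑ j, ∑ i, |H.mulVec x j * mlDeriv c {Sum.inl i, Sum.inr j} (interpPoint H ε r x)| ≤
      2 * l + Fintype.card ι ^ 2 * tailBound ε δ x (H.mulVec x) := by
  have ht := tailBound_nonneg (ε := ε) hδ x (H.mulVec x)
  by_cases h : (∃ i, 1 / 2 < |x i|) ∨ ∃ i, 1 / 2 < |H.mulVec x i|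
  · have h1 : ∀ j i, |H.mulVec x j * mlDeriv c {Sum.inl i, Sum.inr j} (interpPoint H ε r x)| ≤
        tailBound ε δ x (H.mulVec x) := by
      intro j i
      have hV := one_le_prod_max (H.mulVec x)
      have hU := one_le_prod_max x
      rw [abs_mul]
      calc _ ≤ (∏ k, max 1 |H.mulVec x k|) *
            ((∏ k, max 1 |x k|) * (∏ k, max 1 |H.mulVec x k|) ^ 2) :=
            mul_le_mul (abs_le_prod_max _ _)
              ((hb _ _).trans (prod_max_interpPoint_le H x hε hε' hr hr')) (abs_nonneg _)
              (by linarith)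
        _ = (∏ k, max 1 |x k|) * (∏ k, max 1 |H.mulVec x k|) ^ 3 := by ring
        _ ≤ _ := prod_max_mul_le_tailBound hε hε' hδ x _ h
    calc _ ≤ ∑ _j : ι, ∑ _i : ι, tailBound ε δ x (H.mulVec x) :=
          sum_le_sum fun j _ => sum_le_sum fun i _ => h1 j i
      _ = Fintype.card ι ^ 2 * tailBound ε δ x (H.mulVec x) := by
          simp only [sum_const, card_univ, nsmul_eq_mul]
          ring
      _ ≤ _ := by linarith
  · push Not at h
    have h1 := hs _ (abs_interpPoint_le_half H hε hε' hr hr' h.1 h.2)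
    have h2 := sum_pairs_le_sum_card_two
      (f := fun A => |mlDeriv c A (interpPoint H ε r x)|) fun A => abs_nonneg _
    calc _ ≤ ∑ j, ∑ i, 1 / 2 * |mlDeriv c {Sum.inl i, Sum.inr j} (interpPoint H ε r x)| :=
          sum_le_sum fun j _ => sum_le_sum fun i _ => by
            rw [abs_mul]
            exact mul_le_mul_of_nonneg_right (h.2 j) (abs_nonneg _)
      _ = 1 / 2 * ∑ j, ∑ i, |mlDeriv c {Sum.inl i, Sum.inr j} (interpPoint H ε r x)| := by
          simp only [mul_sum]
      _ ≤ 2 * l := by linarith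
      _ ≤ _ := by
          have : (0 : ℝ) ≤ Fintype.card ι ^ 2 * tailBound ε δ x (H.mulVec x) := by positivity
          linarith

lemma abs_trnc_le (a : ℝ) : |trnc a| ≤ 1 :=
  abs_le.2 ⟨le_min (by norm_num) (le_max_left _ _), min_le_left _ _⟩

lemma trnc_eq_self {a : ℝ} (ha : |a| ≤ 1) : trnc a = a := by
  rw [trnc, max_eq_right (abs_le.1 ha).1, min_eq_right (abs_le.1 ha).2]

lemma continuous_trnc : Continuous trnc := by
  unfold trnc
  fun_prop

lemma continuous_mlDeriv (c : Finset ι → ℝ) (A : Finset ι) : Continuous (mlDeriv c A) := by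
  simp only [funext (mlDeriv_eq_sum_subset c A)]
  refine continuous_finsetSum _ fun T _ => ?_
  split_ifs <;> fun_prop

lemma abs_mlDeriv_trnc_le {c : Finset ι → ℝ} (hb : ∀ A z, |mlDeriv c A z| ≤ ∏ k, max 1 |z k|)
    (z : ι → ℝ) : |mlDeriv c ∅ fun k => trnc (z k)| ≤ 1 := by
  refine (hb _ _).trans_eq (prod_eq_one fun k _ => max_eq_left (abs_trnc_le _))

lemma abs_mlDeriv_trnc_sub_le (H : Matrix ι ι ℝ) {c : Finset (ι ⊕ ι) → ℝ} {ε δ : ℝ}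
    (hε : 0 < ε) (hε' : ε ≤ 1 / 16) (hδ : 0 < δ)
    (hb : ∀ A z, |mlDeriv c A z| ≤ ∏ k, max 1 |z k|) (x : ι → ℝ) :
    |(mlDeriv c ∅ fun k => trnc (interpPoint H ε 1 x k)) - mlDeriv c ∅ (interpPoint H ε 1 x)| ≤
      2 * tailBound ε δ x (H.mulVec x) := by
  have ht := tailBound_nonneg (ε := ε) hδ x (H.mulVec x)
  by_cases h : (∃ i, 1 / 2 < |x i|) ∨ ∃ i, 1 / 2 < |H.mulVec x i|
  · have h1 := abs_mlDeriv_trnc_le hb (interpPoint H ε 1 x)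
    have h2 := (hb ∅ _).trans (prod_max_interpPoint_le H x hε hε' zero_le_one le_rfl)
    have h3 := prod_max_mul_le_tailBound hε hε' hδ x _ h
    have hV := one_le_prod_max (H.mulVec x)
    have hU := one_le_prod_max x
    set U := ∏ k, max 1 |x k|
    set V := ∏ k, max 1 |H.mulVec x k|
    have h4 : U * V ^ 2 ≤ U * V ^ 3 :=
      mul_le_mul_of_nonneg_left (pow_le_pow_right₀ hV (by norm_num)) (by linarith)
    have h5 : 1 ≤ U * V ^ 3 := one_le_mul_of_one_le_of_one_le hU (one_le_pow₀ hV)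
    refine (abs_sub _ _).trans ?_
    linarith
  · push Not at h
    have h1 := abs_interpPoint_le_half H hε hε' zero_le_one le_rfl h.1 h.2
    have h2 : (fun k => trnc (interpPoint H ε 1 x k)) = interpPoint H ε 1 x :=
      funext fun k => trnc_eq_self ((h1 k).trans (by norm_num))
    rw [h2, sub_self, abs_zero]
    linarith

lemma integrable_expExcess_mulVec {H : Matrix ι ι ℝ} (hH : H * H.transpose = 1) {v : NNReal}
    (hv : v ≠ 0) : Integrable (fun x : ι → ℝ => expExcess v (H.mulVec x))
      (Measure.pi fun _ => gaussianReal 0 v) := by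
  have h := integrable_expExcess (ι := ι) hv
  rw [← map_mulVec_pi_gaussianReal v hH] at h
  exact h.comp_measurable (measurable_mulVec H)

lemma integral_expExcess_mulVec {H : Matrix ι ι ℝ} (hH : H * H.transpose = 1) {v : NNReal}
    (hv : v ≠ 0) : ∫ x : ι → ℝ, expExcess v (H.mulVec x) ∂(Measure.pi fun _ => gaussianReal 0 v) =
      ∫ x : ι → ℝ, expExcess v x ∂(Measure.pi fun _ => gaussianReal 0 v) := by
  have h := (integrable_expExcess (ι := ι) hv).aestronglyMeasurable
  conv_rhs => rw [← map_mulVec_pi_gaussianReal v hH]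
  rw [← map_mulVec_pi_gaussianReal v hH] at h
  exact (integral_map (measurable_mulVec H).aemeasurable h).symm

lemma integrable_tailBound {H : Matrix ι ι ℝ} (hH : H * H.transpose = 1) {v : NNReal}
    (hv : v ≠ 0) (δ : ℝ) : Integrable (fun x : ι → ℝ => tailBound v δ x (H.mulVec x))
      (Measure.pi fun _ => gaussianReal 0 v) := by
  have h1 := integrable_expExcess (ι := ι) hv
  have h2 := integrable_expExcess_mulVec hH hv
  unfold tailBound
  fun_prop

lemma integral_tailBound {H : Matrix ι ι ℝ} (hH : H * H.transpose = 1) {v : NNReal}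
    (hv : v ≠ 0) (δ : ℝ) :
    ∫ x, tailBound v δ x (H.mulVec x) ∂(Measure.pi fun _ => gaussianReal 0 v) =
      δ * (1 + ∫ x : ι → ℝ, expExcess v x ∂(Measure.pi fun _ => gaussianReal 0 v)) +
        (∫ x : ι → ℝ, expExcess v x ∂(Measure.pi fun _ => gaussianReal 0 v)) / δ := by
  have h1 := integrable_expExcess (ι := ι) hv
  have h2 := integrable_expExcess_mulVec hH hv
  have h3 := integral_expExcess_mulVec hH hv
  have h4 : ∀ x, tailBound v δ x (H.mulVec x) =
      (δ + (δ + 1 / δ) / 2 * expExcess v x) + (δ + 1 / δ) / 2 * expExcess v (H.mulVec x) := by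
    intro x
    unfold tailBound
    ring
  simp only [h4]
  rw [integral_add (by fun_prop) (by fun_prop), integral_add (by fun_prop) (by fun_prop),
    integral_const_mul, integral_const_mul, h3]
  simp only [integral_const, probReal_univ, smul_eq_mul]
  ring

lemma abs_deriv_interpMean_le {H : Matrix ι ι ℝ} (hH : H * H.transpose = 1) {v : NNReal}
    (hv : v ≠ 0) (hv' : (v : ℝ) ≤ 1 / 16) {c : Finset (ι ⊕ ι) → ℝ} {δ r l s : ℝ}
    (hδ : 0 < δ) (hr : 0 ≤ r) (hr' : r ≤ 1) (hl : 0 ≤ l) (hHs : ∀ j i, |H j i| ≤ s) (hs0 : 0 ≤ s)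
    (hb : ∀ A z, |mlDeriv c A z| ≤ ∏ k, max 1 |z k|)
    (hs : ∀ z, (∀ k, |z k| ≤ 1 / 2) → ∑ A with A.card = 2, |mlDeriv c A z| ≤ 4 * l) :
    |v * ∑ j, ∑ i, H j i *
      ∫ x, H.mulVec x j * mlDeriv c {Sum.inl i, Sum.inr j} (interpPoint H v r x)
        ∂(Measure.pi fun _ => gaussianReal 0 v)| ≤
      v * (s * (2 * l + Fintype.card ι ^ 2 * ∫ x, tailBound v δ x (H.mulVec x)
        ∂(Measure.pi fun _ => gaussianReal 0 v))) := by
  have hv0 : (0 : ℝ) < v := by positivity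
  have hint : ∀ j i, Integrable (fun x => |H.mulVec x j *
      mlDeriv c {Sum.inl i, Sum.inr j} (interpPoint H v r x)|)
      (Measure.pi fun _ => gaussianReal 0 v) :=
    fun j i => (integrable_linForm_mul_mlDeriv H v r c _ j).abs
  rw [abs_mul, abs_of_pos hv0]
  refine mul_le_mul_of_nonneg_left ?_ hv0.le
  calc _ ≤ ∑ j, ∑ i, s * ∫ x, |H.mulVec x j * mlDeriv c {Sum.inl i, Sum.inr j}
          (interpPoint H v r x)| ∂(Measure.pi fun _ => gaussianReal 0 v) := by
        refine (abs_sum_le_sum_abs _ _).trans (sum_le_sum fun j _ => ?_)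
        refine (abs_sum_le_sum_abs _ _).trans (sum_le_sum fun i _ => ?_)
        rw [abs_mul]
        exact mul_le_mul (hHs j i) abs_integral_le_integral_abs (abs_nonneg _) hs0
    _ = s * ∫ x, ∑ j, ∑ i, |H.mulVec x j * mlDeriv c {Sum.inl i, Sum.inr j}
          (interpPoint H v r x)| ∂(Measure.pi fun _ => gaussianReal 0 v) := by
        rw [integral_finsetSum _ fun j _ => integrable_finsetSum _ fun i _ => hint j i, mul_sum]
        refine sum_congr rfl fun j _ => ?_
        rw [integral_finsetSum _ fun i _ => hint j i, mul_sum]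
    _ ≤ s * ∫ x, (2 * l + Fintype.card ι ^ 2 * tailBound v δ x (H.mulVec x))
          ∂(Measure.pi fun _ => gaussianReal 0 v) := by
        refine mul_le_mul_of_nonneg_left (integral_mono ?_ ?_ fun x => ?_) hs0
        · exact integrable_finsetSum _ fun j _ => integrable_finsetSum _ fun i _ => hint j i
        · exact (integrable_const _).add ((integrable_tailBound hH hv δ).const_mul _)
        · exact sum_abs_mulVec_mul_mlDeriv_le H hv0 hv' hδ hr hr' hl hb hs x
    _ = _ := by
        rw [integral_add (integrable_const _) ((integrable_tailBound hH hv δ).const_mul _)]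
        simp only [integral_const_mul, integral_const, probReal_univ, smul_eq_mul, one_mul]

lemma abs_integral_trnc_sub_le {H : Matrix ι ι ℝ} (hH : H * H.transpose = 1) {v : NNReal}
    (hv : v ≠ 0) (hv' : (v : ℝ) ≤ 1 / 16) {c : Finset (ι ⊕ ι) → ℝ} {δ l s : ℝ}
    (hδ : 0 < δ) (hl : 0 ≤ l) (hHs : ∀ j i, |H j i| ≤ s) (hs0 : 0 ≤ s)
    (hb : ∀ A z, |mlDeriv c A z| ≤ ∏ k, max 1 |z k|)
    (hs : ∀ z, (∀ k, |z k| ≤ 1 / 2) → ∑ A with A.card = 2, |mlDeriv c A z| ≤ 4 * l) :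
    |∫ x, (mlDeriv c ∅ fun k => trnc (interpPoint H v 1 x k))
        ∂(Measure.pi fun _ => gaussianReal 0 v) - c ∅| ≤
      2 * (∫ x, tailBound v δ x (H.mulVec x) ∂(Measure.pi fun _ => gaussianReal 0 v)) +
      v * (s * (2 * l + Fintype.card ι ^ 2 * ∫ x, tailBound v δ x (H.mulVec x)
        ∂(Measure.pi fun _ => gaussianReal 0 v))) := by
  have hv0 : (0 : ℝ) < v := by positivity
  have h1 : |interpMean H v c 1 - c ∅| ≤ v * (s * (2 * l + Fintype.card ι ^ 2 *
      ∫ x, tailBound v δ x (H.mulVec x) ∂(Measure.pi fun _ => gaussianReal 0 v))) := by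
    rw [← interpMean_zero H v c]
    exact norm_image_sub_le_of_norm_deriv_le_segment_01'
      (fun r _ => (hasDerivAt_interpMean hH hv c r).hasDerivWithinAt) fun r hr =>
        abs_deriv_interpMean_le hH hv hv' hδ hr.1 hr.2.le hl hHs hs0 hb hs
  have hi1 : Integrable (fun x => mlDeriv c ∅ fun k => trnc (interpPoint H v 1 x k))
      (Measure.pi fun _ => gaussianReal 0 v) := by
    refine Integrable.of_bound (C := 1) (Continuous.aestronglyMeasurable ?_)
      (ae_of_all _ fun x => abs_mlDeriv_trnc_le hb _)
    exact (continuous_mlDeriv c ∅).comp (continuous_pi fun k =>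
      continuous_trnc.comp ((continuous_apply k).comp (continuous_interpPoint H v 1)))
  have hi2 : Integrable (fun x => mlDeriv c ∅ (interpPoint H v 1 x))
      (Measure.pi fun _ => gaussianReal 0 v) := by
    simp only [mlDeriv_empty, prod_interpPoint]
    exact integrable_finsetSum _ fun T _ =>
      ((integrable_eval_pi_gaussianReal v _).const_mul _).const_mul _
  have h2 : |∫ x, (mlDeriv c ∅ fun k => trnc (interpPoint H v 1 x k))
      ∂(Measure.pi fun _ => gaussianReal 0 v) - interpMean H v c 1| ≤
      2 * ∫ x, tailBound v δ x (H.mulVec x) ∂(Measure.pi fun _ => gaussianReal 0 v) := by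
    rw [interpMean, ← integral_sub hi1 hi2, ← integral_const_mul]
    refine abs_integral_le_integral_abs.trans (integral_mono (hi1.sub hi2).abs
      ((integrable_tailBound hH hv δ).const_mul 2) fun x => ?_)
    exact abs_mlDeriv_trnc_sub_le H hv0 hv' hδ hb x
  exact (abs_sub_le _ _ _).trans (add_le_add h2 h1)

end Bounds

section Rounding

lemma roundM_apply (a : ℝ) (s : Set ℝ) :
    roundM a s = ((1 + trnc a) / 2).toNNReal * Measure.dirac 1 s +
      ((1 - trnc a) / 2).toNNReal * Measure.dirac (-1) s := by
  rw [roundM, Measure.add_apply]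
  rfl

instance (a : ℝ) : IsProbabilityMeasure (roundM a) := by
  have h := abs_le.1 (abs_trnc_le a)
  refine ⟨?_⟩
  rw [roundM_apply, measure_univ, measure_univ, mul_one, mul_one, ← ENNReal.coe_add,
    ← Real.toNNReal_add (by linarith) (by linarith)]
  ring_nf
  simp

lemma integral_roundM (a : ℝ) : ∫ x, x ∂(roundM a) = trnc a := by
  have h := abs_le.1 (abs_trnc_le a)
  rw [roundM, integral_add_measure (integrable_dirac (by simp)).smul_measure_nnreal
    (integrable_dirac (by simp)).smul_measure_nnreal, integral_smul_nnreal_measure,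
    integral_smul_nnreal_measure, integral_dirac, integral_dirac, NNReal.smul_def, NNReal.smul_def,
    Real.coe_toNNReal _ (by linarith), Real.coe_toNNReal _ (by linarith), smul_eq_mul, smul_eq_mul]
  ring

lemma ae_roundM_abs_le_one (a : ℝ) : ∀ᵐ x ∂(roundM a), |x| ≤ 1 := by
  have hm : MeasurableSet {x : ℝ | |x| ≤ 1} := measurableSet_le (by fun_prop) (by fun_prop)
  rw [ae_iff, roundM_apply]
  have hc : {x : ℝ | ¬|x| ≤ 1} = {x : ℝ | |x| ≤ 1}ᶜ := rfl
  rw [hc, Measure.dirac_apply' _ hm.compl, Measure.dirac_apply' _ hm.compl]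
  simp

lemma measurable_roundM_apply {s : Set ℝ} : Measurable fun a => roundM a s := by
  simp only [roundM_apply]
  have := continuous_trnc.measurable
  fun_prop

variable {κ : Type*} [Fintype κ]

lemma measurable_pi_roundM : Measurable fun z : κ → ℝ => Measure.pi fun i => roundM (z i) := by
  refine Measurable.measure_of_isPiSystem_of_isProbabilityMeasure generateFrom_pi.symm
    isPiSystem_pi ?_
  rintro _ ⟨s, -, rfl⟩
  simp only [Measure.pi_pi]
  exact Finset.measurable_prod _ fun i _ => measurable_roundM_apply.comp (measurable_pi_apply i)

/-- Independent rounding of all coordinates, as a Markov kernel. -/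
def roundKernel (κ : Type*) [Fintype κ] : Kernel (κ → ℝ) (κ → ℝ) where
  toFun z := Measure.pi fun i => roundM (z i)
  measurable' := measurable_pi_roundM

instance : IsMarkovKernel (roundKernel κ) :=
  ⟨fun z => by
    change IsProbabilityMeasure (Measure.pi fun i => roundM (z i))
    infer_instance⟩

lemma ae_pi_roundM_abs_le_one (z : κ → ℝ) :
    ∀ᵐ y ∂(Measure.pi fun i => roundM (z i)), ∀ k, |y k| ≤ 1 :=
  ae_all_iff.2 fun k => (Measure.tendsto_eval_ae_ae (μ := fun i => roundM (z i))).eventually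
    (ae_roundM_abs_le_one (z k))

variable [DecidableEq κ]

lemma integral_mlDeriv_pi_roundM (c : Finset κ → ℝ) (z : κ → ℝ) :
    ∫ y, mlDeriv c ∅ y ∂(Measure.pi fun i => roundM (z i)) =
      mlDeriv c ∅ fun k => trnc (z k) := by
  have hi : ∀ T : Finset κ, Integrable (fun y : κ → ℝ => ∏ k ∈ T, y k)
      (Measure.pi fun i => roundM (z i)) := fun T =>
    Integrable.of_bound (C := 1) (Continuous.aestronglyMeasurable (by fun_prop)) (by
      filter_upwards [ae_pi_roundM_abs_le_one z] with y hy
      rw [Real.norm_eq_abs, abs_prod]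
      exact prod_le_one (fun k _ => abs_nonneg _) fun k _ => hy k)
  simp only [mlDeriv_empty]
  rw [integral_finsetSum _ fun T _ => (hi T).const_mul _]
  refine sum_congr rfl fun T _ => ?_
  have h1 : ∀ y : κ → ℝ, ∏ k ∈ T, y k =
      ∏ k, (fun (k : κ) (t : ℝ) => if k ∈ T then t else 1) k (y k) :=
    fun y => (Fintype.prod_ite_mem T y).symm
  rw [integral_const_mul, integral_congr_ae (ae_of_all _ h1), integral_fintype_prod_eq_prod
    (𝕜 := ℝ) (fun (k : κ) (t : ℝ) => if k ∈ T then t else 1), ← Fintype.prod_ite_mem T]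
  congr 1
  refine prod_congr rfl fun k _ => ?_
  split_ifs
  · exact integral_roundM _
  · simp

lemma integral_mlDeriv_bind_pi_roundM (μ : Measure (κ → ℝ)) [IsProbabilityMeasure μ]
    {c : Finset κ → ℝ} (hb : ∀ A z, |mlDeriv c A z| ≤ ∏ k, max 1 |z k|) :
    ∫ y, mlDeriv c ∅ y ∂(μ.bind fun z => Measure.pi fun i => roundM (z i)) =
      ∫ z, (mlDeriv c ∅ fun k => trnc (z k)) ∂μ := by
  have hm : MeasurableSet {y : κ → ℝ | ‖mlDeriv c ∅ y‖ ≤ 1} :=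
    measurableSet_le (continuous_mlDeriv c ∅).norm.measurable measurable_const
  have hae : ∀ᵐ y ∂(roundKernel κ ∘ₘ μ), ‖mlDeriv c ∅ y‖ ≤ 1 := by
    refine Measure.ae_comp_of_ae_ae hm (ae_of_all _ fun z => ?_)
    filter_upwards [ae_pi_roundM_abs_le_one z] with y hy
    exact (hb _ _).trans_eq (prod_eq_one fun k _ => max_eq_left (hy k))
  have hi : Integrable (mlDeriv c ∅) (roundKernel κ ∘ₘ μ) :=
    Integrable.of_bound (continuous_mlDeriv c ∅).aestronglyMeasurable 1 hae
  change ∫ y, mlDeriv c ∅ y ∂(roundKernel κ ∘ₘ μ) = _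
  rw [Measure.comp_eq_comp_const_apply] at hi ⊢
  rw [Kernel.integral_comp hi]
  exact integral_congr_ae (ae_of_all _ fun z => integral_mlDeriv_pi_roundM c z)

lemma integral_mlDeriv_Dmeas (C : ℝ) (n : ℕ) {c : Finset (BV n ⊕ BV n) → ℝ}
    (hb : ∀ A z, |mlDeriv c A z| ≤ ∏ k, max 1 |z k|) :
    ∫ y, mlDeriv c ∅ y ∂(Dmeas C n) =
      ∫ x, (mlDeriv c ∅ fun k => trnc (interpPoint (Had n) (eps C n) 1 x k)) ∂(gaussVec C n) := by
  have h : (fun X : BV n → ℝ => (Sum.elim X fun i => ((Had n).mulVec X i) ^ 2 - eps C n :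
      BV n ⊕ BV n → ℝ)) = interpPoint (Had n) (eps C n) 1 := by
    ext X (i | j) <;> simp [interpPoint]
  have hc := continuous_interpPoint (Had n) (eps C n) 1
  have : IsProbabilityMeasure (gaussVec C n) :=
    inferInstanceAs (IsProbabilityMeasure (Measure.pi _))
  have : IsProbabilityMeasure (Gmeas' C n) := by
    rw [Gmeas', h]
    exact Measure.isProbabilityMeasure_map hc.aemeasurable
  rw [Dmeas, integral_mlDeriv_bind_pi_roundM _ hb, Gmeas', h,
    integral_map hc.aemeasurable (Continuous.aestronglyMeasurable ?_)]
  exact (continuous_mlDeriv c ∅).comp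
    (continuous_pi fun k => continuous_trnc.comp (continuous_apply k))

end Rounding

section Parameters

variable {C : ℝ} {n : ℕ}

lemma log_two_pow_ge (hn : 1 ≤ n) : 1 / 2 ≤ Real.log (2 ^ n) := by
  have h1 : (1 : ℝ) ≤ n := by exact_mod_cast hn
  rw [Real.log_pow]
  nlinarith [Real.log_two_gt_d9]

lemma eps_pos (hC : 512 ≤ C) (hn : 1 ≤ n) : 0 < eps C n := by
  have := log_two_pow_ge hn
  unfold eps
  positivity

lemma eps_le (hC : 512 ≤ C) (hn : 1 ≤ n) : eps C n ≤ 1 / 16 := by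
  have := log_two_pow_ge hn
  exact one_div_le_one_div_of_le (by norm_num) (by nlinarith)

lemma exp_neg_inv_eps_mul_le (hC : 512 ≤ C) (hn : 1 ≤ n) :
    Real.exp (-(1 / (128 * eps C n))) * (2 ^ n) ^ 4 ≤ 1 := by
  have hL := log_two_pow_ge hn
  have h1 : ((2 : ℝ) ^ n) ^ 4 = Real.exp (4 * Real.log (2 ^ n)) := by
    rw [mul_comm, ← Real.rpow_def_of_pos (by positivity)]
    norm_cast
  have h2 : 1 / (128 * eps C n) = C * Real.log (2 ^ n) / 128 := by
    unfold eps
    have : C ≠ 0 := by linarith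
    field_simp
  rw [h1, h2, ← Real.exp_add, Real.exp_le_one_iff]
  nlinarith

lemma exp_neg_inv_le {ε : ℝ} (hε : 0 < ε) : Real.exp (-(1 / (128 * ε))) ≤ 128 * ε := by
  rw [Real.exp_neg, inv_le_comm₀ (Real.exp_pos _) (by positivity), ← one_div]
  linarith [Real.add_one_le_exp (1 / (128 * ε))]

end Parameters

/-- If the Gaussian tail weight `p ^ 8` is polynomially small in the dimension `M`, then the
error terms of the interpolation argument are absorbed by the main term `ε l / √M`. -/
lemma error_terms_le {p M ε η B l : ℝ} (hp : 0 < p) (hM : 2 ≤ M) (hε : 0 < ε)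
    (hpM : p * M ^ 4 ≤ 1) (hpε : p ≤ 128 * ε) (hη : η ≤ 8 * p ^ 8 * M)
    (hB : B = p ^ 2 * (1 + η) + η / p ^ 2) (hl : 1 ≤ l) :
    2 * B + ε * (1 / Real.sqrt M * (2 * l + M ^ 2 * B)) ≤ 773 * ε * l / Real.sqrt M := by
  have hM4 : 16 ≤ M ^ 4 := by nlinarith [sq_nonneg (M ^ 2 - 4), sq_nonneg (M - 2)]
  have hp1 : p ≤ 1 / 16 := by nlinarith
  have hM0 : 0 < Real.sqrt M := Real.sqrt_pos.2 (by linarith)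
  have hMM : M ≤ M ^ 4 := le_self_pow₀ (by linarith) (by norm_num)
  have hsM : Real.sqrt M ≤ M ^ 4 :=
    (Real.sqrt_le_iff.2 ⟨by linarith, by nlinarith⟩ : Real.sqrt M ≤ M).trans hMM
  have hps : p * Real.sqrt M ≤ 1 := (mul_le_mul_of_nonneg_left hsM hp.le).trans hpM
  have hpM1 : p * M ≤ 1 := (mul_le_mul_of_nonneg_left hMM hp.le).trans hpM
  have hη' : η ≤ p ^ 6 := by
    have h1 : 8 * p * (p * M) ≤ 1 := by nlinarith
    calc η ≤ p ^ 6 * (8 * p * (p * M)) := by linarith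
      _ ≤ p ^ 6 := mul_le_of_le_one_right (by positivity) h1
  have hB3 : B ≤ 3 * p ^ 2 := by
    have h1 : η / p ^ 2 ≤ p ^ 4 := by
      rw [div_le_iff₀ (by positivity)]
      linarith
    have h2 : p ^ 4 ≤ p ^ 2 := pow_le_pow_of_le_one hp.le (by linarith) (by norm_num)
    have h3 : p ^ 6 ≤ 1 := pow_le_one₀ hp.le (by linarith)
    nlinarith [sq_nonneg p]
  have h1 : p ^ 2 ≤ 128 * ε / Real.sqrt M := by
    rw [le_div_iff₀ hM0]
    nlinarith
  have h2 : M ^ 2 * B ≤ 3 := by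
    have : (p * M) ^ 2 ≤ 1 := pow_le_one₀ (by positivity) hpM1
    nlinarith [sq_nonneg M]
  calc _ ≤ 2 * (3 * (128 * ε / Real.sqrt M)) + ε * (1 / Real.sqrt M * (5 * l)) := by
        refine add_le_add (by linarith) (mul_le_mul_of_nonneg_left
          (mul_le_mul_of_nonneg_left (by linarith) (by positivity)) hε.le)
    _ = (768 * ε + 5 * ε * l) / Real.sqrt M := by
        field_simp
        ring
    _ ≤ _ := by
        gcongr
        nlinarith

/-- There exist universal constants `C₀ ≥ 20` and `K` such that for every
`C ≥ C₀`, every `ℓ ≥ 1` and every multilinear `F : ℝ^{2N} → ℝ` mapping `{±1}^{2N}` into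
`{±1}` with `L_{1,2}(F_ρ) ≤ ℓ` for every restriction `ρ`,
`|E_{z' ~ D}[F z'] - F 0| ≤ K ε ℓ / √N`. -/
theorem stmt0 :
    ∃ C₀ K : ℝ, 20 ≤ C₀ ∧
      ∀ C : ℝ, C₀ ≤ C → ∀ n : ℕ, 1 ≤ n → ∀ ℓ : ℝ, 1 ≤ ℓ →
      ∀ F : (BV n ⊕ BV n → ℝ) → ℝ, IsMultilinear F →
        (∀ z : BV n ⊕ BV n → ℝ, (∀ i, z i = 1 ∨ z i = -1) → (F z = 1 ∨ F z = -1)) →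
        (∀ (S : Finset (BV n ⊕ BV n)) (w : BV n ⊕ BV n → ℝ),
            (∀ i ∉ S, w i = 1 ∨ w i = -1) → L12 (restrictML F S w) ≤ ℓ) →
        |(∫ z, F z ∂(Dmeas C n)) - F (fun _ => 0)| ≤
          K * eps C n * ℓ / Real.sqrt (2 ^ n) := by
  refine ⟨512, 773, by norm_num, fun C hC n hn l hl F ⟨c, hc⟩ hF hL => ?_⟩
  have hε := eps_pos hC hn
  have hv : (eps C n).toNNReal ≠ 0 := (Real.toNNReal_pos.2 hε).ne'
  have hvε : ((eps C n).toNNReal : ℝ) = eps C n := Real.coe_toNNReal _ hε.le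
  have hFc : ∀ z, F z = mlDeriv c ∅ z := fun z => (hc z).trans (mlDeriv_empty c z).symm
  have hb : ∀ A z, |mlDeriv c A z| ≤ ∏ k, max 1 |z k| := fun A z => abs_mlDeriv_le c A (fun p => by
    rw [← hFc]
    rcases hF (fun k => bitSign (p k)) fun k => by cases p k <;> simp [bitSign] with h | h <;>
      simp [h]) z
  have hF0 : F (fun _ => 0) = c ∅ := by
    rw [hc, sum_eq_single ∅ (fun T _ hT => ?_) (by simp)]
    · simp
    · obtain ⟨k, hk⟩ := nonempty_iff_ne_empty.2 hT
      rw [prod_eq_zero hk rfl, mul_zero]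
  have hcard : (Fintype.card (BV n) : ℝ) = 2 ^ n := by simp
  have hM : (2 : ℝ) ≤ 2 ^ n := by simpa using pow_le_pow_right₀ (by norm_num : (1 : ℝ) ≤ 2) hn
  have hpM := exp_neg_inv_eps_mul_le hC hn
  have hp := Real.exp_pos (-(1 / (128 * eps C n)))
  have hp8 : Real.exp (-(1 / (16 * eps C n))) = Real.exp (-(1 / (128 * eps C n))) ^ 8 := by
    rw [← Real.exp_nat_mul]
    congr 1
    field_simp
    norm_num
  set p := Real.exp (-(1 / (128 * eps C n))) with hpdef
  have hη := integral_expExcess_le (ι := BV n) hv (by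
    rw [hvε, hp8, hcard]
    have hp1 : p ≤ 1 / 16 := by nlinarith [pow_le_pow_left₀ (by norm_num) hM 4]
    have hpM1 : p * 2 ^ n ≤ 1 := (mul_le_mul_of_nonneg_left
      (le_self_pow₀ (by linarith) (by norm_num)) hp.le).trans hpM
    have hp7 : p ^ 7 ≤ 1 / 16 := (pow_le_of_le_one hp.le (by linarith) (by norm_num)).trans hp1
    calc 4 * p ^ 8 * 2 ^ n = 4 * p ^ 7 * (p * 2 ^ n) := by ring
      _ ≤ 1 := by nlinarith [pow_pos hp 7])
  rw [hvε, hp8, hcard] at hη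
  have hmain := abs_integral_trnc_sub_le (Had_mul_transpose n) hv (hvε.trans_le (eps_le hC hn))
    (c := c) (δ := p ^ 2) (l := l) (s := 1 / Real.sqrt (2 ^ n)) (by positivity) (by linarith)
    (fun j i => (abs_Had n j i).le) (by positivity) hb (sum_abs_mlDeriv_le hc hL)
  have hB := integral_tailBound (Had_mul_transpose n) hv (p ^ 2)
  rw [hvε] at hmain hB
  rw [hcard] at hmain
  rw [hF0, funext hFc, integral_mlDeriv_Dmeas C n hb]
  exact hmain.trans (error_terms_le hp hM hε hpM (exp_neg_inv_le hε) hη hB hl)
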